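/- arXiv:2312.05914 — 3 statements merged into one kernel-verified Lean document; each statement's English description precedes it below -/
import Mathlib

section
/- Let R be a commutative Noetherian local ring of Krull dimension d, and let M and N be nonzero finitely generated R-modules such that N is Tor-rigid. Suppose that Hom_R(M,N) has finite injective dimension and that Ext_R^i(M,N) = 0 for all 1 ≤ i ≤ d. Then M is free and N has finite injective dimension. -/
open CategoryTheory

noncomputable section

/-- The `i`-th Ext module of two `R`-modules. -/
def extMod (R : Type) [CommRing R] (i : ℕ) (M N : Type) [AddCommGroup M] [Module R M]
    [AddCommGroup N] [Module R N] : ModuleCat R :=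
  ((Ext R (ModuleCat R) i).obj (Opposite.op (ModuleCat.of R M))).obj (ModuleCat.of R N)

/-- The `i`-th Tor module of two `R`-modules. -/
def torMod (R : Type) [CommRing R] (i : ℕ) (M N : Type) [AddCommGroup M] [Module R M]
    [AddCommGroup N] [Module R N] : ModuleCat R :=
  ((Tor (ModuleCat R) i).obj (ModuleCat.of R M)).obj (ModuleCat.of R N)

/-- The depth of a module over a local ring: the infimum of the set of
indices `i` with `Ext^i(R/𝔪, N) ≠ 0`. -/
def moduleDepth (R : Type) [CommRing R] [IsLocalRing R] (N : Type) [AddCommGroup N]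
    [Module R N] : ℕ :=
  sInf {i : ℕ | ¬ Subsingleton (extMod R i (R ⧸ IsLocalRing.maximalIdeal R) N)}

/-- An `R`-module `N` has finite injective dimension iff there is an `n` such that
`Ext^i(M, N) = 0` for all modules `M` and all `i > n`. -/
def HasFiniteInjDim (R : Type) [CommRing R] (N : Type) [AddCommGroup N] [Module R N] : Prop :=
  ∃ n : ℕ, ∀ (M : Type) [AddCommGroup M] [Module R M], ∀ i : ℕ, n < i →
    Subsingleton (extMod R i M N)

/-- An `R`-module `M` has finite projective dimension iff there is an `n` such that
`Ext^i(M, N) = 0` for all modules `N` and all `i > n`. -/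
def HasFiniteProjDim (R : Type) [CommRing R] (M : Type) [AddCommGroup M] [Module R M] : Prop :=
  ∃ n : ℕ, ∀ (N : Type) [AddCommGroup N] [Module R N], ∀ i : ℕ, n < i →
    Subsingleton (extMod R i M N)

/-- The `𝔪`-torsion submodule `Γ_𝔪(M)` of a module over a local ring. -/
def mTorsion (R : Type) [CommRing R] [IsLocalRing R] (M : Type) [AddCommGroup M]
    [Module R M] : Submodule R M :=
  ⨆ n : ℕ, Submodule.torsionBySet R M ((IsLocalRing.maximalIdeal R ^ n : Ideal R) : Set R)

/-- A semidualizing module: the natural map `R → Hom(C,C)` is bijective and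
`Ext^i(C,C) = 0` for all `i ≥ 1`. -/
structure IsSemidualizing (R : Type) [CommRing R] (C : Type) [AddCommGroup C]
    [Module R C] : Prop where
  bijective : Function.Bijective (LinearMap.lsmul R C)
  ext_vanish : ∀ i : ℕ, 1 ≤ i → Subsingleton (extMod R i C C)

/-- Membership in the Auslander class `A_C(R)`: the natural map `M → Hom(C, C ⊗ M)` is
bijective, `Tor_i(C, M) = 0` and `Ext^i(C, C ⊗ M) = 0` for all `i ≥ 1`. -/
structure MemAuslanderClass (R : Type) [CommRing R] (C : Type) [AddCommGroup C] [Module R C]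
    (M : Type) [AddCommGroup M] [Module R M] : Prop where
  bijective : Function.Bijective ((TensorProduct.mk R C M).flip)
  tor_vanish : ∀ i : ℕ, 1 ≤ i → Subsingleton (torMod R i C M)
  ext_vanish : ∀ i : ℕ, 1 ≤ i → Subsingleton (extMod R i C (TensorProduct R C M))

/-- A module `N` is Tor-rigid if for every finitely generated module `M` and every `i ≥ 1`,
`Tor_i(M, N) = 0` implies `Tor_{i+1}(M, N) = 0`. -/
def IsTorRigid (R : Type) [CommRing R] (N : Type) [AddCommGroup N] [Module R N] : Prop :=
  ∀ (M : Type) [AddCommGroup M] [Module R M], Module.Finite R M →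
    ∀ i : ℕ, 1 ≤ i → Subsingleton (torMod R i M N) → Subsingleton (torMod R (i + 1) M N)

/-- The natural map `C ⊗ Hom(M,N) → Hom(M, C ⊗ N)`, sending `c ⊗ φ` to `m ↦ c ⊗ φ m`. -/
def homTensorMap (R : Type) [CommRing R] (C M N : Type) [AddCommGroup C] [Module R C]
    [AddCommGroup M] [Module R M] [AddCommGroup N] [Module R N] :
    TensorProduct R C (M →ₗ[R] N) →ₗ[R] (M →ₗ[R] TensorProduct R C N) :=
  TensorProduct.lift
    ((LinearMap.llcomp R M N (TensorProduct R C N)).comp (TensorProduct.mk R C N))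


/-- Vanishing of the `i`-th Ext group of two `R`-modules. -/
def ExtVanishes (R : Type) [CommRing R] (i : ℕ) (X Y : Type) [AddCommGroup X] [Module R X]
    [AddCommGroup Y] [Module R Y] : Prop :=
  Subsingleton (Abelian.Ext (ModuleCat.of R X) (ModuleCat.of R Y) i)

section ExtVanishing

variable {R : Type} [CommRing R]
  {A B C X Y : Type} [AddCommGroup A] [Module R A] [AddCommGroup B] [Module R B]
  [AddCommGroup C] [Module R C] [AddCommGroup X] [Module R X] [AddCommGroup Y] [Module R Y]

theorem subsingleton_extMod_succ_iff (n : ℕ) :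
    Subsingleton (extMod R (n + 1) X Y) ↔ ExtVanishes R (n + 1) X Y := by
  let P := ProjectiveResolution.of (ModuleCat.of R X)
  let Z := ModuleCat.of R Y
  trans ∀ f : P.complex.X (n + 1) ⟶ Z, P.complex.d (n + 2) (n + 1) ≫ f = 0 →
      ∃ g : P.complex.X n ⟶ Z, P.complex.d (n + 1) n ≫ g = f
  · have e := P.isoExt (R := R) (n + 1) Z
    have h1 : Subsingleton (extMod R (n + 1) X Y) ↔
        (P.complex.linearYonedaObj R Z).ExactAt (n + 1) := by
      rw [HomologicalComplex.exactAt_iff_isZero_homology, ← e.isZero_iff,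
        ModuleCat.isZero_iff_subsingleton]
      rfl
    rw [h1, HomologicalComplex.exactAt_iff' _ n (n + 1) (n + 2) (by simp) (by simp),
      ShortComplex.moduleCat_exact_iff]
    rfl
  · constructor
    · intro h
      refine ⟨fun a b => ?_⟩
      have key : ∀ a : Abelian.Ext (ModuleCat.of R X) (ModuleCat.of R Y) (n + 1), a = 0 := by
        intro a
        obtain ⟨f, hf, rfl⟩ := P.extMk_surjective a (n + 2) rfl
        exact (P.extMk_eq_zero_iff f (n + 2) rfl hf n rfl).2 (h f hf)
      rw [key a, key b]
    · intro h f hf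
      exact (P.extMk_eq_zero_iff f (n + 2) rfl hf n rfl).1 (h.elim _ _)

/-- The short complex of modules attached to an exact pair of linear maps. -/
abbrev exactShortComplex (f : A →ₗ[R] B) (g : B →ₗ[R] C) (h : Function.Exact f g) :
    ShortComplex (ModuleCat R) :=
  ShortComplex.mk (ModuleCat.ofHom f) (ModuleCat.ofHom g)
    (by ext x; exact h.apply_apply_eq_zero x)

theorem exactShortComplex_shortExact {f : A →ₗ[R] B} {g : B →ₗ[R] C}
    (hf : Function.Injective f) (h : Function.Exact f g) (hg : Function.Surjective g) :
    (exactShortComplex f g h).ShortExact where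
  exact := ModuleCat.shortComplex_exact _ h
  mono_f := (ModuleCat.mono_iff_injective _).2 hf
  epi_g := (ModuleCat.epi_iff_surjective _).2 hg

theorem extVanishes_of_forall_eq_zero {i : ℕ}
    (h : ∀ x : Abelian.Ext (ModuleCat.of R X) (ModuleCat.of R Y) i, x = 0) :
    ExtVanishes R i X Y :=
  ⟨fun a b => by rw [h a, h b]⟩

theorem ExtVanishes.eq_zero {i : ℕ} (h : ExtVanishes R i X Y)
    (x : Abelian.Ext (ModuleCat.of R X) (ModuleCat.of R Y) i) : x = 0 :=
  h.elim _ _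

section ShortExact

variable {f : A →ₗ[R] B} {g : B →ₗ[R] C} (hf : Function.Injective f) (h : Function.Exact f g)
  (hg : Function.Surjective g)

include hf h hg

theorem ExtVanishes.middle {i : ℕ} (hA : ExtVanishes R i A Y) (hC : ExtVanishes R i C Y) :
    ExtVanishes R i B Y :=
  extVanishes_of_forall_eq_zero fun x => by
    obtain ⟨y, rfl⟩ := Abelian.Ext.contravariant_sequence_exact₂
      (exactShortComplex_shortExact hf h hg) (ModuleCat.of R Y) x (hA.eq_zero _)
    rw [hC.eq_zero y, Abelian.Ext.comp_zero]

theorem ExtVanishes.right {i : ℕ} (hA : ExtVanishes R i A Y) (hB : ExtVanishes R (i + 1) B Y) :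
    ExtVanishes R (i + 1) C Y :=
  extVanishes_of_forall_eq_zero fun x => by
    obtain ⟨y, rfl⟩ := Abelian.Ext.contravariant_sequence_exact₃
      (exactShortComplex_shortExact hf h hg) (ModuleCat.of R Y) x (hB.eq_zero _) (add_comm 1 i)
    rw [hA.eq_zero y, Abelian.Ext.comp_zero]

theorem ExtVanishes.left {i : ℕ} (hB : ExtVanishes R i B Y) (hC : ExtVanishes R (i + 1) C Y) :
    ExtVanishes R i A Y :=
  extVanishes_of_forall_eq_zero fun x => by
    obtain ⟨y, rfl⟩ := Abelian.Ext.contravariant_sequence_exact₁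
      (exactShortComplex_shortExact hf h hg) (ModuleCat.of R Y) x (add_comm 1 i) (hC.eq_zero _)
    rw [hB.eq_zero y, Abelian.Ext.comp_zero]

theorem ExtVanishes.target_right {i : ℕ} (hB : ExtVanishes R i X B)
    (hA : ExtVanishes R (i + 1) X A) : ExtVanishes R i X C :=
  extVanishes_of_forall_eq_zero fun x => by
    obtain ⟨y, rfl⟩ := Abelian.Ext.covariant_sequence_exact₃ (ModuleCat.of R X)
      (exactShortComplex_shortExact hf h hg) x rfl (hA.eq_zero _)
    rw [hB.eq_zero y, Abelian.Ext.zero_comp]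

theorem ExtVanishes.target_left {i : ℕ} (hC : ExtVanishes R i X C)
    (hB : ExtVanishes R (i + 1) X B) : ExtVanishes R (i + 1) X A :=
  extVanishes_of_forall_eq_zero fun x => by
    obtain ⟨y, rfl⟩ := Abelian.Ext.covariant_sequence_exact₁ (ModuleCat.of R X)
      (exactShortComplex_shortExact hf h hg) x (hB.eq_zero _) rfl
    rw [hC.eq_zero y, Abelian.Ext.zero_comp]

/-- If `Ext¹(X, A) = 0`, maps from `X` lift along `B → C`. -/
theorem ExtVanishes.exists_lift (hA : ExtVanishes R 1 X A) (φ : X →ₗ[R] C) :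
    ∃ ψ : X →ₗ[R] B, g ∘ₗ ψ = φ := by
  obtain ⟨y, hy⟩ := Abelian.Ext.covariant_sequence_exact₃ (ModuleCat.of R X)
      (exactShortComplex_shortExact hf h hg) (Abelian.Ext.mk₀ (ModuleCat.ofHom φ)) rfl
      (hA.eq_zero _)
  obtain ⟨ψ, rfl⟩ := (Abelian.Ext.mk₀_bijective _ _).2 y
  refine ⟨ψ.hom, ?_⟩
  rw [Abelian.Ext.mk₀_comp_mk₀] at hy
  have := (Abelian.Ext.mk₀_bijective _ _).1 hy
  ext x
  exact LinearMap.congr_fun (congrArg ModuleCat.Hom.hom this) x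

/-- If `Ext¹(C, Y) = 0`, maps to `Y` extend along `A → B`. -/
theorem ExtVanishes.exists_extend (hC : ExtVanishes R 1 C Y) (φ : A →ₗ[R] Y) :
    ∃ ψ : B →ₗ[R] Y, ψ ∘ₗ f = φ := by
  obtain ⟨y, hy⟩ := Abelian.Ext.contravariant_sequence_exact₁
      (exactShortComplex_shortExact hf h hg) (ModuleCat.of R Y)
      (Abelian.Ext.mk₀ (ModuleCat.ofHom φ)) rfl (hC.eq_zero _)
  obtain ⟨ψ, rfl⟩ := (Abelian.Ext.mk₀_bijective _ _).2 y
  refine ⟨ψ.hom, ?_⟩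
  rw [Abelian.Ext.mk₀_comp_mk₀] at hy
  have := (Abelian.Ext.mk₀_bijective _ _).1 hy
  ext x
  exact LinearMap.congr_fun (congrArg ModuleCat.Hom.hom this) x

end ShortExact

theorem extVanishes_zero_iff : ExtVanishes R 0 X Y ↔ ∀ φ : X →ₗ[R] Y, φ = 0 := by
  constructor
  · intro h φ
    have := (Abelian.Ext.mk₀_bijective (ModuleCat.of R X) (ModuleCat.of R Y)).1
      (h.elim (Abelian.Ext.mk₀ (ModuleCat.ofHom φ)) (Abelian.Ext.mk₀ (ModuleCat.ofHom 0)))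
    ext x
    exact LinearMap.congr_fun (congrArg ModuleCat.Hom.hom this) x
  · intro h
    refine extVanishes_of_forall_eq_zero fun x => ?_
    obtain ⟨ψ, rfl⟩ := (Abelian.Ext.mk₀_bijective _ _).2 x
    have : ψ = 0 := by
      ext x
      exact LinearMap.congr_fun (h ψ.hom) x
    rw [this, Abelian.Ext.mk₀_zero]

theorem ExtVanishes.congr_source {i : ℕ} (e : A ≃ₗ[R] B) (h : ExtVanishes R i A Y) :
    ExtVanishes R i B Y := by
  refine extVanishes_of_forall_eq_zero fun x => ?_
  have h1 : ModuleCat.ofHom e.symm.toLinearMap ≫ ModuleCat.ofHom e.toLinearMap = 𝟙 _ := by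
    ext x; simp
  have h2 := h.eq_zero ((Abelian.Ext.mk₀ (ModuleCat.ofHom e.toLinearMap)).comp x (zero_add i))
  rw [← Abelian.Ext.mk₀_id_comp x, ← h1, ← Abelian.Ext.mk₀_comp_mk₀_assoc, h2,
    Abelian.Ext.comp_zero]

theorem ExtVanishes.congr_target {i : ℕ} (e : A ≃ₗ[R] B) (h : ExtVanishes R i X A) :
    ExtVanishes R i X B := by
  refine extVanishes_of_forall_eq_zero fun x => ?_
  have h1 : ModuleCat.ofHom e.symm.toLinearMap ≫ ModuleCat.ofHom e.toLinearMap = 𝟙 _ := by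
    ext x; simp
  have h2 := h.eq_zero (x.comp (Abelian.Ext.mk₀ (ModuleCat.ofHom e.symm.toLinearMap))
    (add_zero i))
  rw [← Abelian.Ext.comp_mk₀_id x, ← h1, ← Abelian.Ext.mk₀_comp_mk₀,
    ← Abelian.Ext.comp_assoc_of_third_deg_zero, h2, Abelian.Ext.zero_comp]

theorem extVanishes_succ_of_injective [Module.Injective R Y] (i : ℕ) :
    ExtVanishes R (i + 1) X Y := by
  have : Injective (ModuleCat.of R Y) := Module.injective_object_of_injective_module R Y
  exact extVanishes_of_forall_eq_zero fun x => Abelian.Ext.eq_zero_of_injective x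

theorem extVanishes_succ_of_projective [Module.Projective R X] (i : ℕ) :
    ExtVanishes R (i + 1) X Y := by
  have : Projective (ModuleCat.of R X) := (IsProjective.iff_projective X).1 inferInstance
  exact extVanishes_of_forall_eq_zero fun x => Abelian.Ext.eq_zero_of_projective x

end ExtVanishing

section InjectiveDimension

variable {R : Type} [CommRing R] [IsNoetherianRing R] [IsLocalRing R]
  {T : Type} [AddCommGroup T] [Module R T] [Module.Finite R T]

open IsLocalRing

theorem ExtVanishes.of_isSMulRegular {Y C : Type} [AddCommGroup Y] [Module R Y]
    [Module.Finite R Y] [AddCommGroup C] [Module R C] {x : R} (hx : x ∈ maximalIdeal R)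
    (hreg : IsSMulRegular Y x) {g : Y →ₗ[R] C} (h : Function.Exact (LinearMap.lsmul R Y x) g)
    (hg : Function.Surjective g) {i : ℕ} (hC : ExtVanishes R (i + 1) C T) :
    ExtVanishes R i Y T := by
  have hf : Function.Injective (LinearMap.lsmul R Y x) := hreg
  have key : (⊤ : Submodule R (Abelian.Ext (ModuleCat.of R Y) (ModuleCat.of R T) i)) = ⊥ := by
    refine Submodule.eq_bot_of_le_smul_of_le_jacobson_bot (maximalIdeal R) _
      (Module.Finite.fg_top) ?_ (IsLocalRing.maximalIdeal_le_jacobson _)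
    intro e _
    obtain ⟨y, rfl⟩ := Abelian.Ext.contravariant_sequence_exact₁
      (exactShortComplex_shortExact hf h hg) (ModuleCat.of R T) e (add_comm 1 i) (hC.eq_zero _)
    have : (exactShortComplex (LinearMap.lsmul R Y x) g h).f = x • 𝟙 (ModuleCat.of R Y) := rfl
    rw [this, Abelian.Ext.mk₀_smul, Abelian.Ext.smul_comp, Abelian.Ext.mk₀_id_comp]
    exact Submodule.smul_mem_smul hx trivial
  exact extVanishes_of_forall_eq_zero fun e => by
    have : e ∈ (⊤ : Submodule R (Abelian.Ext (ModuleCat.of R Y) (ModuleCat.of R T) i)) := trivial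
    rwa [key] at this

omit [IsNoetherianRing R] [IsLocalRing R] in
theorem extVanishes_of_subsingleton {Y : Type} [AddCommGroup Y] [Module R Y] [Subsingleton Y]
    {S : Type} [AddCommGroup S] [Module R S] (i : ℕ) : ExtVanishes R i Y S := by
  cases i with
  | zero => exact extVanishes_zero_iff.2 fun φ => Subsingleton.elim _ _
  | succ i => exact extVanishes_succ_of_projective i

theorem extVanishes_of_surjective_of_residue {r : ℕ}
    (hk : ∀ i, r < i → ExtVanishes R i (R ⧸ maximalIdeal R) T) :
    ∀ I : Ideal R, ∀ (Y : Type) [AddCommGroup Y] [Module R Y] (φ : R →ₗ[R] Y),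
      Function.Surjective φ → LinearMap.ker φ = I → ∀ i, r < i → ExtVanishes R i Y T := by
  intro I
  induction I using WellFoundedGT.induction with
  | ind I ih =>
  intro Y _ _ φ hφ hker i hi
  have : Module.Finite R Y := Module.Finite.of_surjective φ hφ
  by_cases htop : I = ⊤
  · have : Subsingleton Y := by
      refine subsingleton_of_forall_eq 0 fun y => ?_
      obtain ⟨a, rfl⟩ := hφ y
      have : a ∈ LinearMap.ker φ := by rw [hker, htop]; trivial
      exact this
    exact extVanishes_of_subsingleton i
  by_cases hm : maximalIdeal R ≤ I
  · have hI : LinearMap.ker φ = maximalIdeal R := by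
      rw [hker]; exact le_antisymm (le_maximalIdeal htop) hm
    refine (hk i hi).congr_source ?_
    exact (Submodule.quotEquivOfEq _ _ hI.symm).trans (φ.quotKerEquivOfSurjective hφ)
  obtain ⟨x, hxm, hxI⟩ := Set.not_subset.1 hm
  let S : Submodule R Y := R ∙ φ x
  have hquot : ∀ i, r < i → ExtVanishes R i (Y ⧸ S) T := by
    refine ih (LinearMap.ker (S.mkQ ∘ₗ φ)) ?_ (Y ⧸ S) (S.mkQ ∘ₗ φ)
      ((Submodule.mkQ_surjective S).comp hφ) rfl
    refine lt_of_le_of_ne ?_ ?_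
    · intro a ha
      rw [← hker] at ha
      have : φ a = 0 := ha
      simp [this]
    · rintro h
      apply hxI
      have : x ∈ LinearMap.ker (S.mkQ ∘ₗ φ) := by
        simp [S, Submodule.mem_span_singleton_self]
      exact h ▸ this
  let ψ : R →ₗ[R] S := LinearMap.toSpanSingleton R S ⟨φ x, Submodule.mem_span_singleton_self _⟩
  have hψ : Function.Surjective ψ := by
    rintro ⟨y, hy⟩
    obtain ⟨a, rfl⟩ := Submodule.mem_span_singleton.1 hy
    exact ⟨a, rfl⟩
  have hψm : ∀ a, ψ a = 0 ↔ a • φ x = 0 := fun a => by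
    rw [← Subtype.coe_inj]; rfl
  have hle : I ≤ LinearMap.ker ψ := by
    intro a ha
    rw [← hker, LinearMap.mem_ker] at ha
    rw [LinearMap.mem_ker, hψm, ← map_smul, smul_eq_mul, mul_comm, ← smul_eq_mul, map_smul, ha,
      smul_zero]
  rcases hle.lt_or_eq with hlt | heq
  · have hS := ih _ hlt S ψ hψ rfl i hi
    exact ExtVanishes.middle (f := S.subtype) (g := S.mkQ) S.subtype_injective
      (LinearMap.exact_subtype_mkQ S) S.mkQ_surjective hS (hquot i hi)
  · refine ExtVanishes.of_isSMulRegular (g := S.mkQ) hxm ?_ ?_ S.mkQ_surjective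
      (hquot (i + 1) (by omega))
    · refine (isSMulRegular_iff_right_eq_zero_of_smul ..).2 fun y hy => ?_
      obtain ⟨a, rfl⟩ := hφ y
      have : a ∈ I := by
        rw [heq, LinearMap.mem_ker, hψm, ← map_smul, smul_eq_mul, mul_comm, ← smul_eq_mul,
          map_smul, hy]
      rw [← hker] at this
      exact this
    · intro y
      rw [Submodule.mkQ_apply, Submodule.Quotient.mk_eq_zero, Submodule.mem_span_singleton]
      constructor
      · rintro ⟨a, rfl⟩
        exact ⟨φ a, by
          rw [LinearMap.lsmul_apply, ← map_smul, ← map_smul, smul_eq_mul, smul_eq_mul, mul_comm]⟩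
      · rintro ⟨z, rfl⟩
        obtain ⟨a, rfl⟩ := hφ z
        exact ⟨a, by
          rw [LinearMap.lsmul_apply, ← map_smul, ← map_smul, smul_eq_mul, smul_eq_mul, mul_comm]⟩

/-- Vanishing of `Ext(k, T)` above degree `r` for the residue field `k` implies vanishing of
`Ext(Y, T)` above degree `r` for every finitely generated module `Y`. -/
theorem extVanishes_of_residue {r : ℕ}
    (hk : ∀ i, r < i → ExtVanishes R i (R ⧸ maximalIdeal R) T)
    (Y : Type) [AddCommGroup Y] [Module R Y] [hY : Module.Finite R Y] :
    ∀ i, r < i → ExtVanishes R i Y T := by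
  induction hY using IsNoetherianRing.induction_on_isQuotientEquivQuotientPrime R with
  | subsingleton Y => exact fun i _ => extVanishes_of_subsingleton i
  | quotient Y p e =>
    intro i hi
    exact (extVanishes_of_surjective_of_residue hk _ (R ⧸ p.1) (Submodule.mkQ p.1)
      (Submodule.mkQ_surjective _) rfl i hi).congr_source e.symm
  | exact A B C f g hf hg h hA hC =>
    exact fun i hi => ExtVanishes.middle hf h hg (hA i hi) (hC i hi)

omit [IsNoetherianRing R] in
theorem injective_of_residue {Y : Type} [AddCommGroup Y] [Module R Y]
    {φ : (R ⧸ maximalIdeal R) →ₗ[R] Y} (hφ : φ ≠ 0) : Function.Injective φ := by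
  have : IsSimpleModule R (R ⧸ maximalIdeal R) :=
    isSimpleModule_iff_isCoatom.2 (Ideal.isMaximal_def.1 (maximalIdeal.isMaximal R))
  exact (LinearMap.injective_or_eq_zero φ).resolve_right hφ

omit [Module.Finite R T] in
/-- A finitely generated module containing the residue field, obtained by killing regular elements
of a module `Y`, with control of the vanishing of `Ext`. -/
theorem exists_injective_residue_of_supportDim {n : ℕ} (Y : Type) [AddCommGroup Y] [Module R Y]
    [Module.Finite R Y] [Nontrivial Y] (hn : Module.supportDim R Y ≤ n) (d : ℕ) (hd : n ≤ d)
    (hY : ∀ i, d - n < i → ExtVanishes R i Y T) :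
    ∃ (Z : Type) (_ : AddCommGroup Z) (_ : Module R Z) (_ : Module.Finite R Z)
      (φ : (R ⧸ maximalIdeal R) →ₗ[R] Z), Function.Injective φ ∧
      ∀ i, d < i → ExtVanishes R i Z T := by
  induction n generalizing Y with
  | zero =>
    by_cases hsub : Subsingleton ((R ⧸ maximalIdeal R) →ₗ[R] Y)
    · exfalso
      obtain ⟨x, hx, hreg⟩ := IsSMulRegular.subsingleton_linearMap_iff.1 hsub
      rw [Ideal.annihilator_quotient] at hx
      have hnt : Nontrivial (QuotSMulTop x Y) := by
        rw [Submodule.Quotient.nontrivial_iff]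
        exact (Submodule.top_ne_pointwise_smul_of_mem_jacobson_annihilator
          (maximalIdeal_le_jacobson _ hx)).symm
      obtain ⟨s, hs⟩ := WithBot.ne_bot_iff_exists.1
        ((Module.supportDim_ne_bot_iff_nontrivial R (QuotSMulTop x Y)).2 hnt)
      rw [← Module.supportDim_quotSMulTop_succ_eq_supportDim hreg hx, ← hs] at hn
      norm_cast at hn
      simp at hn
    · rw [not_subsingleton_iff_nontrivial] at hsub
      obtain ⟨φ, hφ⟩ := exists_ne (0 : (R ⧸ maximalIdeal R) →ₗ[R] Y)
      exact ⟨Y, _, _, inferInstance, φ, injective_of_residue hφ,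
        fun i hi => hY i (by omega)⟩
  | succ n ih =>
    by_cases hsub : Subsingleton ((R ⧸ maximalIdeal R) →ₗ[R] Y)
    · obtain ⟨x, hx, hreg⟩ := IsSMulRegular.subsingleton_linearMap_iff.1 hsub
      rw [Ideal.annihilator_quotient] at hx
      have hnt : Nontrivial (QuotSMulTop x Y) := by
        rw [Submodule.Quotient.nontrivial_iff]
        exact (Submodule.top_ne_pointwise_smul_of_mem_jacobson_annihilator
          (maximalIdeal_le_jacobson _ hx)).symm
      obtain ⟨s, hs⟩ := WithBot.ne_bot_iff_exists.1
        ((Module.supportDim_ne_bot_iff_nontrivial R (QuotSMulTop x Y)).2 hnt)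
      refine ih (QuotSMulTop x Y) ?_ (by omega) fun i hi => ?_
      · rw [← Module.supportDim_quotSMulTop_succ_eq_supportDim hreg hx, ← hs] at hn
        rw [← hs]
        norm_cast at hn ⊢
        push_cast at hn
        exact (ENat.add_le_add_iff_right ENat.one_ne_top).1 hn
      · obtain ⟨j, rfl⟩ : ∃ j, i = j + 1 := ⟨i - 1, by omega⟩
        exact ExtVanishes.right (f := LinearMap.lsmul R Y x) hreg
          (LinearMap.exact_lsmul_mkQ_smul_top Y x) (Submodule.mkQ_surjective _)
          (hY j (by omega)) (hY (j + 1) (by omega))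
    · rw [not_subsingleton_iff_nontrivial] at hsub
      obtain ⟨φ, hφ⟩ := exists_ne (0 : (R ⧸ maximalIdeal R) →ₗ[R] Y)
      exact ⟨Y, _, _, inferInstance, φ, injective_of_residue hφ,
        fun i hi => hY i (by omega)⟩

/-- A finitely generated module of finite injective dimension over a local ring of dimension `d`
has injective dimension at most `d`, in the form of a vanishing statement for the residue field. -/
theorem extVanishes_residue_of_ringKrullDim_lt {d : ℕ} (hd : ringKrullDim R = d) (r : ℕ)
    (hr : ∀ i, r < i → ExtVanishes R i (R ⧸ maximalIdeal R) T) :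
    ∀ i, d < i → ExtVanishes R i (R ⧸ maximalIdeal R) T := by
  obtain ⟨Z, _, _, _, φ, hφ, hZ⟩ := exists_injective_residue_of_supportDim (T := T) R
    (n := d) (by rw [Module.supportDim_self_eq_ringKrullDim, hd]) d le_rfl
    (fun i hi => by
      obtain ⟨j, rfl⟩ : ∃ j, i = j + 1 := ⟨i - 1, by omega⟩
      exact extVanishes_succ_of_projective j)
  induction r with
  | zero => exact fun i hi => hr i (by omega)
  | succ r ih =>
    by_cases hdr : r + 1 ≤ d
    · exact fun i hi => hr i (by omega)
    refine ih fun i hi => ?_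
    rcases Nat.lt_or_ge (r + 1) i with h | h
    · exact hr i h
    obtain rfl : i = r + 1 := by omega
    exact ExtVanishes.left hφ (LinearMap.exact_map_mkQ_range φ) (Submodule.mkQ_surjective _)
      (hZ _ (by omega)) (extVanishes_of_residue hr _ _ (by omega))

omit [Module.Finite R T] in
/-- A nonzero finitely generated module over a local ring of dimension `d` has depth at most
`d`. -/
theorem exists_not_extVanishes_residue {d : ℕ} (hd : ringKrullDim R = d) (N : Type)
    [AddCommGroup N] [Module R N] [Module.Finite R N] [Nontrivial N] :
    ∃ j ≤ d, ¬ ExtVanishes R j (R ⧸ maximalIdeal R) N := by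
  by_contra! h
  obtain ⟨rs, hlen, -, hreg⟩ := ModuleCat.exists_isRegular_of_exists_subsingleton_ext
    (maximalIdeal R) (d + 1) (ModuleCat.of R N)
    (Submodule.top_ne_ideal_smul_of_le_jacobson_annihilator
      (maximalIdeal_le_jacobson _)).symm.lt_top
    (ModuleCat.of R (R ⧸ maximalIdeal R))
    (by rw [Module.support_eq_zeroLocus, Ideal.annihilator_quotient])
    (fun i hi => h i (by omega))
  have h1 := Module.supportDim_add_length_eq_supportDim_of_isRegular rs hreg
  have h2 := Module.supportDim_le_ringKrullDim R N
  have hnt : Nontrivial (N ⧸ Ideal.ofList rs • (⊤ : Submodule R N)) :=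
    Submodule.Quotient.nontrivial_iff.2 hreg.2.symm
  obtain ⟨s, hs⟩ := WithBot.ne_bot_iff_exists.1
        ((Module.supportDim_ne_bot_iff_nontrivial R _).2 hnt)
  change Module.supportDim R (N ⧸ Ideal.ofList rs • (⊤ : Submodule R N)) + _ =
    Module.supportDim R N at h1
  rw [← h1, ← hs, hd, hlen] at h2
  norm_cast at h2
  have : ((d + 1 : ℕ) : ℕ∞) ≤ (d : ℕ) := le_trans le_add_self h2
  norm_cast at this
  omega

end InjectiveDimension

section Resolutions

variable {R : Type} [CommRing R]

theorem injective_of_retract {A B : Type} [AddCommGroup A] [Module R A] [AddCommGroup B]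
    [Module R B] [Module.Injective R B] (i : A →ₗ[R] B) (p : B →ₗ[R] A)
    (h : ∀ a, p (i a) = a) : Module.Injective R A where
  out X Y _ _ _ _ f hf g := by
    obtain ⟨l, hl⟩ := Module.Injective.out f hf (i ∘ₗ g)
    exact ⟨p ∘ₗ l, fun x => by simp [hl, h]⟩

theorem exists_maximal_disjoint {A : Type} [AddCommGroup A] [Module R A] (S B : Submodule R A)
    (h : Disjoint S B) : ∃ H, B ≤ H ∧ Maximal (fun H => Disjoint S H) H := by
  refine zorn_le_nonempty₀ {H | Disjoint S H} (fun c hc hchain y _ => ?_) B h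
  exact ⟨sSup c, (hchain.directedOn.disjoint_sSup_right).2 fun b hb => hc hb,
    fun z hz => le_sSup hz⟩

/-- Every submodule of an injective module has an essential extension in it which is a direct
summand. -/
theorem exists_injective_essential {I : Type} [AddCommGroup I] [Module R I] [Module.Injective R I]
    (A : Submodule R I) :
    ∃ C : Submodule R I, A ≤ C ∧ Module.Injective R C ∧ ∀ L ≤ C, Disjoint A L → L = ⊥ := by
  obtain ⟨H, -, hH⟩ := exists_maximal_disjoint A ⊥ disjoint_bot_right
  obtain ⟨C, hAC, hC⟩ := exists_maximal_disjoint H A hH.prop.symm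
  let j : C →ₗ[R] I ⧸ H := H.mkQ ∘ₗ C.subtype
  have hj : Function.Injective j := by
    refine (injective_iff_map_eq_zero j).2 fun c hc => ?_
    have : (c : I) ∈ H := (Submodule.Quotient.mk_eq_zero H).1 hc
    exact Subtype.ext (Submodule.disjoint_def.1 hC.prop _ this c.2)
  obtain ⟨θ, hθ⟩ := Module.Injective.out j hj C.subtype
  let τ : I →ₗ[R] I := θ ∘ₗ H.mkQ
  have hτC : ∀ c ∈ C, τ c = c := fun c hc => hθ ⟨c, hc⟩
  have hτH : ∀ x ∈ H, τ x = 0 := fun x hx => by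
    have : H.mkQ x = 0 := (Submodule.Quotient.mk_eq_zero H).2 hx
    simp [τ, this]
  have hV : H.comap τ ≤ H := by
    refine hH.le_of_ge ?_ fun x hx => ?_
    · refine Submodule.disjoint_def.2 fun a ha ha' => ?_
      rw [Submodule.mem_comap, hτC a (hAC ha)] at ha'
      exact Submodule.disjoint_def.1 hH.prop a ha ha'
    · rw [Submodule.mem_comap, hτH x hx]; exact H.zero_mem
  have hrange : LinearMap.range τ ≤ C := by
    refine hC.le_of_ge ?_ fun c hc => ⟨c, hτC c hc⟩
    rw [disjoint_comm]
    refine Submodule.disjoint_def.2 ?_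
    rintro _ ⟨x, rfl⟩ hx
    exact hτH x (hV hx)
  refine ⟨C, hAC, ?_, fun L hLC hL => ?_⟩
  · exact injective_of_retract C.subtype (τ.codRestrict C fun x => hrange ⟨x, rfl⟩)
      fun c => Subtype.ext (hτC c c.2)
  · have hLH : L ⊔ H ≤ H := by
      refine hH.le_of_ge ?_ le_sup_right
      refine Submodule.disjoint_def.2 fun a ha ha' => ?_
      obtain ⟨l, hl, x, hx, rfl⟩ := Submodule.mem_sup.1 ha'
      have hxC : x ∈ C := by
        have := C.sub_mem (hAC ha) (hLC hl)
        simpa using this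
      have hx0 : x = 0 := Submodule.disjoint_def.1 hC.prop x hx hxC
      subst hx0
      rw [add_zero] at ha ⊢
      exact Submodule.disjoint_def.1 hL l ha hl
    refine eq_bot_iff.2 fun l hl => ?_
    exact Submodule.disjoint_def.1 hC.prop l (hLH (Submodule.mem_sup_left hl)) (hLC hl)

variable [IsLocalRing R]

open IsLocalRing

/-- Every module embeds in an injective module with the same socle. -/
theorem exists_injective_socle_le (A : ModuleCat.{0} R) :
    ∃ (E : ModuleCat.{0} R) (ι : A →ₗ[R] E), Module.Injective R E ∧ Function.Injective ι ∧
      ∀ z : E, (∀ x ∈ maximalIdeal R, x • z = 0) → z ∈ LinearMap.range ι := by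
  let I : ModuleCat.{0} R := Injective.under A
  have : Injective (ModuleCat.of R I) := inferInstanceAs (Injective (Injective.under A))
  have : Module.Injective R I := Module.injective_module_of_injective_object R I
  let ι : A →ₗ[R] I := (Injective.ι A).hom
  have hι : Function.Injective ι := (ModuleCat.mono_iff_injective _).1 inferInstance
  obtain ⟨C, hAC, hC, hess⟩ := exists_injective_essential (LinearMap.range ι)
  refine ⟨ModuleCat.of R C, ι.codRestrict C fun a => hAC ⟨a, rfl⟩, hC, ?_, fun z hz => ?_⟩
  · intro a b hab
    exact hι (congrArg Subtype.val hab)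
  · by_contra hzA
    have hzA' : (z : I) ∉ LinearMap.range ι := by
      rintro ⟨a, ha⟩
      exact hzA ⟨a, Subtype.ext ha⟩
    have hz' : ∀ x ∈ maximalIdeal R, x • (z : I) = 0 := fun x hx =>
      congrArg Subtype.val (hz x hx)
    have := hess (R ∙ (z : I)) ((Submodule.span_singleton_le_iff_mem _ _).2 z.2) ?_
    · rw [Submodule.span_singleton_eq_bot] at this
      exact hzA' (this ▸ Submodule.zero_mem _)
    · refine Submodule.disjoint_def.2 fun a ha ha' => ?_
      obtain ⟨r, rfl⟩ := Submodule.mem_span_singleton.1 ha'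
      by_cases hr : r ∈ maximalIdeal R
      · exact hz' r hr
      · have hu : IsUnit r := by simpa using hr
        exact absurd ((Submodule.smul_mem_iff_of_isUnit _ hu).1 ha) hzA'

/-- A minimal injective resolution, cut into short exact sequences. -/
theorem exists_minimal_injective_resolution (N : Type) [AddCommGroup N] [Module R N] :
    ∃ (S I : ℕ → ModuleCat.{0} R) (_ : N ≃ₗ[R] S 0) (ι : ∀ j, S j →ₗ[R] I j)
      (π : ∀ j, I j →ₗ[R] S (j + 1)), ∀ j, Module.Injective R (I j) ∧ Function.Injective (ι j) ∧
      Function.Exact (ι j) (π j) ∧ Function.Surjective (π j) ∧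
      ∀ z : I j, (∀ x ∈ maximalIdeal R, x • z = 0) → π j z = 0 := by
  choose E ι hE hι hsoc using exists_injective_socle_le (R := R)
  let q : ∀ A : ModuleCat.{0} R, E A →ₗ[R] E A ⧸ LinearMap.range (ι A) :=
    fun A => (LinearMap.range (ι A)).mkQ
  have hexact : ∀ A, Function.Exact (ι A) (q A) := fun A => LinearMap.exact_map_mkQ_range (ι A)
  have hq : ∀ A, Function.Surjective (q A) := fun A => Submodule.mkQ_surjective _
  have hker : ∀ A, ∀ z ∈ LinearMap.range (ι A), q A z = 0 :=
    fun A z hz => (Submodule.Quotient.mk_eq_zero _).2 hz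
  let S : ℕ → ModuleCat.{0} R := fun j =>
    Nat.rec (ModuleCat.of R N) (fun _ A => ModuleCat.of R (E A ⧸ LinearMap.range (ι A))) j
  refine ⟨S, fun j => E (S j), LinearEquiv.refl R N, fun j => ι (S j),
    fun j => q (S j), fun j => ⟨hE _, hι _, hexact (S j), hq (S j),
      fun z hz => hker (S j) z (hsoc _ z hz)⟩⟩

theorem exists_minimal_cover (A : Type) [AddCommGroup A] [Module R A] [Module.Finite R A] :
    ∃ (n : ℕ) (ρ : (Fin n → R) →ₗ[R] A), Function.Surjective ρ ∧
      ∀ v, ρ v = 0 → ∀ a, v a ∈ maximalIdeal R := by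
  have : Module.Free (ResidueField R) (TensorProduct R (ResidueField R) A) :=
    Module.Free.of_divisionRing _ _
  let b := Module.finBasis (ResidueField R) (TensorProduct R (ResidueField R) A)
  have hex : ∀ t : TensorProduct R (ResidueField R) A, ∃ a : A, 1 ⊗ₜ[R] a = t := by
    intro t
    have h := (map_tensorProduct_mk_eq_top (R := R) (M := A) (N := ⊤)).2 rfl
    rw [Submodule.map_top, LinearMap.range_eq_top] at h
    exact h t
  choose f hf using fun i => hex (b i)
  refine ⟨_, Fintype.linearCombination R f, ?_, fun v hv a => ?_⟩
  · rw [← LinearMap.range_eq_top, Fintype.range_linearCombination]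
    exact IsLocalRing.span_eq_top_of_tmul_eq_basis f b hf
  · rw [Fintype.linearCombination_apply] at hv
    have h1 : ∑ i, residue R (v i) • b i = 0 := by
      have := congrArg (TensorProduct.mk R (ResidueField R) A 1) hv
      rw [map_zero, map_sum] at this
      rw [← this]
      refine Finset.sum_congr rfl fun i _ => ?_
      rw [← hf, map_smul, TensorProduct.mk_apply]
      rfl
    have := Fintype.linearIndependent_iff.1 b.linearIndependent _ h1 a
    exact (residue_eq_zero_iff _).1 this

/-- A minimal free resolution, cut into short exact sequences. -/
theorem exists_minimal_free_resolution [IsNoetherianRing R] (M : Type) [AddCommGroup M] [Module R M]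
    [Module.Finite R M] :
    ∃ (S : ℕ → ModuleCat.{0} R) (n : ℕ → ℕ) (_ : M ≃ₗ[R] S 0)
      (κ : ∀ i, S (i + 1) →ₗ[R] (Fin (n i) → R)) (ρ : ∀ i, (Fin (n i) → R) →ₗ[R] S i),
      ∀ i, Module.Finite R (S i) ∧ Function.Injective (κ i) ∧ Function.Exact (κ i) (ρ i) ∧
        Function.Surjective (ρ i) ∧ ∀ v a, κ i v a ∈ maximalIdeal R := by
  choose n ρ hρ hmin using fun A : {A : ModuleCat.{0} R // Module.Finite R A} =>
    @exists_minimal_cover R _ _ A.1 _ _ A.2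
  let S : ℕ → {A : ModuleCat.{0} R // Module.Finite R A} := fun j =>
    Nat.rec ⟨ModuleCat.of R M, inferInstanceAs (Module.Finite R M)⟩
      (fun _ A => ⟨ModuleCat.of R (LinearMap.ker (ρ A)),
        inferInstanceAs (Module.Finite R (LinearMap.ker (ρ A)))⟩) j
  refine ⟨fun i => (S i).1, fun i => n (S i), LinearEquiv.refl R M,
    fun i => (LinearMap.ker (ρ (S i))).subtype, fun i => ρ (S i), fun i =>
    ⟨(S i).2, Submodule.subtype_injective _, LinearMap.exact_subtype_ker_map _, hρ _, ?_⟩⟩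
  exact fun v a => hmin (S i) _ v.2 a

end Resolutions

section HomGrid

variable {R : Type} [CommRing R] {F E : ℕ → Type} [∀ i, AddCommGroup (F i)]
  [∀ i, Module R (F i)] [∀ j, AddCommGroup (E j)] [∀ j, Module R (E j)]

variable (R F E) in
/-- Families of linear maps `F i → E j`, the terms of a Hom double complex. -/
abbrev HomGrid : Type := ∀ i j, F i →ₗ[R] E j

namespace HomGrid

variable (p : ∀ i, F (i + 1) →ₗ[R] F i) (q : ∀ j, E j →ₗ[R] E (j + 1))

/-- Precomposition with the differentials of `F`. -/
def row : HomGrid R F E →ₗ[R] HomGrid R F E where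
  toFun f := fun i j => match i with
    | 0 => 0
    | i + 1 => f i j ∘ₗ p i
  map_add' f g := by
    funext i j
    cases i <;> simp [LinearMap.add_comp]
  map_smul' r f := by
    funext i j
    cases i <;> simp [LinearMap.smul_comp]

/-- Postcomposition with the differentials of `E`, with the sign of the row index. -/
def col : HomGrid R F E →ₗ[R] HomGrid R F E where
  toFun f := fun i j => match j with
    | 0 => 0
    | j + 1 => (-1 : R) ^ i • (q j ∘ₗ f i j)
  map_add' f g := by
    funext i j
    cases j <;> simp [LinearMap.comp_add]
  map_smul' r f := by
    funext i j
    cases j <;> simp [LinearMap.comp_smul, smul_comm r]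

/-- The differential of the total complex. -/
def diff : HomGrid R F E →ₗ[R] HomGrid R F E := row p + col q

theorem diff_zero_zero (f : HomGrid R F E) : diff p q f 0 0 = 0 := by
  simp [diff, row, col]

theorem diff_succ_zero (f : HomGrid R F E) (i : ℕ) :
    diff p q f (i + 1) 0 = f i 0 ∘ₗ p i := by
  simp [diff, row, col]

theorem diff_zero_succ (f : HomGrid R F E) (j : ℕ) :
    diff p q f 0 (j + 1) = q j ∘ₗ f 0 j := by
  simp [diff, row, col]

theorem diff_succ_succ (f : HomGrid R F E) (i j : ℕ) :
    diff p q f (i + 1) (j + 1) =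
      f i (j + 1) ∘ₗ p i + (-1 : R) ^ (i + 1) • (q j ∘ₗ f (i + 1) j) := rfl

variable {p q}

theorem diff_diff (hp : ∀ i, p i ∘ₗ p (i + 1) = 0) (hq : ∀ j, q (j + 1) ∘ₗ q j = 0)
    (f : HomGrid R F E) : diff p q (diff p q f) = 0 := by
  have hp' : ∀ i x, p i (p (i + 1) x) = 0 := fun i x => LinearMap.congr_fun (hp i) x
  have hq' : ∀ j x, q (j + 1) (q j x) = 0 := fun j x => LinearMap.congr_fun (hq j) x
  funext i j
  ext x
  rcases i with _ | _ | i <;> rcases j with _ | _ | j <;>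
    simp [diff_zero_zero, diff_succ_zero, diff_zero_succ, diff_succ_succ, hp', hq', pow_succ]

/-- The family with a single nonzero entry. -/
def single (i j : ℕ) : (F i →ₗ[R] E j) →ₗ[R] HomGrid R F E :=
  LinearMap.single R (fun a => ∀ b, F a →ₗ[R] E b) i ∘ₗ
    LinearMap.single R (fun b => F i →ₗ[R] E b) j

theorem single_same (i j : ℕ) (φ : F i →ₗ[R] E j) : single i j φ i j = φ := by
  simp [single]

theorem single_of_ne {i j a b : ℕ} (φ : F i →ₗ[R] E j) (h : a ≠ i ∨ b ≠ j) :
    single i j φ a b = 0 := by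
  rcases eq_or_ne a i with rfl | ha
  · simp [single, Pi.single_eq_of_ne (h.resolve_left (by simp))]
  · simp [single, Pi.single_eq_of_ne ha]

theorem diff_single (i j : ℕ) (φ : F i →ₗ[R] E j) :
    diff p q (single i j φ) =
      single (i + 1) j (φ ∘ₗ p i) + (-1 : R) ^ i • single i (j + 1) (q j ∘ₗ φ) := by
  have hrow : row p (single i j φ) = single (i + 1) j (φ ∘ₗ p i) := by
    funext a b
    rcases a with _ | a
    · rw [single_of_ne _ (Or.inl (by omega))]; rfl
    · change single i j φ a b ∘ₗ p a = _
      by_cases h : a = i ∧ b = j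
      · obtain ⟨rfl, rfl⟩ := h
        rw [single_same, single_same]
      · rw [single_of_ne _ (by omega), single_of_ne _ (by omega), LinearMap.zero_comp]
  have hcol : col q (single i j φ) = (-1 : R) ^ i • single i (j + 1) (q j ∘ₗ φ) := by
    funext a b
    rcases b with _ | b
    · change 0 = (-1 : R) ^ i • single i (j + 1) (q j ∘ₗ φ) a 0
      rw [single_of_ne _ (Or.inr (by omega)), smul_zero]
    · change (-1 : R) ^ a • (q b ∘ₗ single i j φ a b) =
        (-1 : R) ^ i • single i (j + 1) (q j ∘ₗ φ) a (b + 1)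
      by_cases h : a = i ∧ b = j
      · obtain ⟨rfl, rfl⟩ := h
        rw [single_same, single_same]
      · rw [single_of_ne _ (by omega), single_of_ne _ (by omega), LinearMap.comp_zero, smul_zero,
          smul_zero]
  rw [diff, LinearMap.add_apply, hrow, hcol]

variable (R F E) in
/-- The part of total degree `m`. -/
def homogeneous (m : ℕ) : Submodule R (HomGrid R F E) where
  carrier := {f | ∀ i j, i + j ≠ m → f i j = 0}
  add_mem' hf hg i j h := by
    rw [Pi.add_apply, Pi.add_apply, hf i j h, hg i j h, add_zero]
  zero_mem' _ _ _ := rfl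
  smul_mem' r f hf i j h := by
    rw [Pi.smul_apply, Pi.smul_apply, hf i j h, smul_zero]

theorem single_mem_homogeneous {i j m : ℕ} (h : i + j = m) (φ : F i →ₗ[R] E j) :
    single i j φ ∈ homogeneous R F E m :=
  fun a b hab => single_of_ne φ (by omega)

variable (p q) in
theorem diff_mem_homogeneous {m : ℕ} {f : HomGrid R F E} (hf : f ∈ homogeneous R F E m) :
    diff p q f ∈ homogeneous R F E (m + 1) := by
  intro i j h
  rcases i with _ | i <;> rcases j with _ | j
  · exact diff_zero_zero p q f
  · rw [diff_zero_succ, hf _ _ (by omega), LinearMap.comp_zero]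
  · rw [diff_succ_zero, hf _ _ (by omega), LinearMap.zero_comp]
  · rw [diff_succ_succ, hf _ _ (by omega), hf _ _ (by omega), LinearMap.comp_zero,
      LinearMap.zero_comp, smul_zero, add_zero]

theorem injective_homogeneous [∀ i j, Module.Injective R (F i →ₗ[R] E j)] (m : ℕ) :
    Module.Injective R (homogeneous R F E m) := by
  let P : HomGrid R F E →ₗ[R] homogeneous R F E m :=
    { toFun f := ⟨fun i j => if i + j = m then f i j else 0, fun i j h => if_neg h⟩
      map_add' f g := by
        ext i j : 3
        by_cases h : i + j = m <;> simp [h]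
      map_smul' r f := by
        ext i j : 3
        by_cases h : i + j = m <;> simp [h] }
  refine injective_of_retract (homogeneous R F E m).subtype P fun f => ?_
  ext i j : 3
  by_cases h : i + j = m
  · exact if_pos h
  · exact (if_neg h).trans (f.2 i j h).symm

variable (p q) in
/-- Cocycles of degree `m` in the total complex. -/
def cocycles (m : ℕ) : Submodule R (HomGrid R F E) :=
  homogeneous R F E m ⊓ LinearMap.ker (diff p q)

theorem exists_diff_eq (hp : ∀ i, p i ∘ₗ p (i + 1) = 0) (hq : ∀ j, q (j + 1) ∘ₗ q j = 0)
    (hcol : ∀ i j, ∀ φ : F i →ₗ[R] E (j + 1), q (j + 1) ∘ₗ φ = 0 →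
      ∃ ψ : F i →ₗ[R] E j, q j ∘ₗ ψ = φ) {m : ℕ}
    (hcorner : ∀ φ : F (m + 1) →ₗ[R] E 0, q 0 ∘ₗ φ = 0 → φ ∘ₗ p (m + 1) = 0 →
      ∃ ψ : F m →ₗ[R] E 0, q 0 ∘ₗ ψ = 0 ∧ ψ ∘ₗ p m = φ)
    {f : HomGrid R F E} (hf : f ∈ cocycles p q (m + 1)) :
    ∃ g ∈ homogeneous R F E m, diff p q g = f := by
  have hunit : ∀ i : ℕ, (-1 : R) ^ i * (-1) ^ i = 1 := fun i => by
    rw [← mul_pow]; simp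
  have hreduce : ∀ g ∈ homogeneous R F E m, f - diff p q g ∈ cocycles p q (m + 1) :=
    fun g hg => ⟨sub_mem hf.1 (diff_mem_homogeneous p q hg), by
      have h0 : diff p q f = 0 := hf.2
      change diff p q (_ - _) = 0
      rw [map_sub, h0, diff_diff hp hq, sub_zero]⟩
  have hclear : ∀ k ≤ m + 1, ∃ g ∈ homogeneous R F E m, ∀ i < k, ∀ j,
      (f - diff p q g) i j = 0 := by
    intro k
    induction k with
    | zero => exact fun _ => ⟨0, zero_mem _, fun i hi => absurd hi (by omega)⟩
    | succ k ih =>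
      intro hk
      obtain ⟨g, hg, hgf⟩ := ih (by omega)
      obtain ⟨hh, hd⟩ := hreduce g hg
      set f' := f - diff p q g with hf'
      obtain ⟨j, hj⟩ : ∃ j, k + j = m := ⟨m - k, by omega⟩
      have h0 : q (j + 1) ∘ₗ f' k (j + 1) = 0 := by
        have h1 : diff p q f' k (j + 2) = 0 := by rw [LinearMap.mem_ker.1 hd]; rfl
        rcases k with _ | k
        · rwa [diff_zero_succ] at h1
        · rw [diff_succ_succ, hgf k (by omega), LinearMap.zero_comp, zero_add] at h1
          have := congrArg (fun u => (-1 : R) ^ (k + 1) • u) h1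
          simpa only [smul_smul, hunit, one_smul, smul_zero] using this
      obtain ⟨ψ, hψ⟩ := hcol k j _ h0
      refine ⟨g + (-1 : R) ^ k • single k j ψ,
        add_mem hg (Submodule.smul_mem _ _ (single_mem_homogeneous hj ψ)), fun i hi b => ?_⟩
      have h2 : f - diff p q (g + (-1 : R) ^ k • single k j ψ) =
          f' - ((-1 : R) ^ k • single (k + 1) j (ψ ∘ₗ p k) +
            single k (j + 1) (f' k (j + 1))) := by
        rw [map_add, ← sub_sub, ← hf', map_smul, diff_single, hψ, smul_add, smul_smul, hunit,
          one_smul]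
      rw [h2]
      simp only [Pi.sub_apply, Pi.add_apply, Pi.smul_apply]
      rw [single_of_ne _ (Or.inl (by omega)), smul_zero, zero_add]
      by_cases hc : i = k ∧ b = j + 1
      · obtain ⟨rfl, rfl⟩ := hc
        rw [single_same, sub_self]
      · rw [single_of_ne _ (by omega), sub_zero]
        rcases Nat.lt_succ_iff_lt_or_eq.1 hi with hi | rfl
        · exact hgf i hi b
        · exact hh i b (by omega)
  obtain ⟨g, hg, hgf⟩ := hclear (m + 1) le_rfl
  obtain ⟨hh, hd⟩ := hreduce g hg
  set f' := f - diff p q g with hf'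
  have h0 : q 0 ∘ₗ f' (m + 1) 0 = 0 := by
    have h1 : diff p q f' (m + 1) 1 = 0 := by rw [LinearMap.mem_ker.1 hd]; rfl
    rw [diff_succ_succ, hgf m (by omega), LinearMap.zero_comp, zero_add] at h1
    have := congrArg (fun u => (-1 : R) ^ (m + 1) • u) h1
    simpa only [smul_smul, hunit, one_smul, smul_zero] using this
  have h1 : f' (m + 1) 0 ∘ₗ p (m + 1) = 0 := by
    rw [← diff_succ_zero p q, LinearMap.mem_ker.1 hd]; rfl
  obtain ⟨ψ, hψ0, hψ⟩ := hcorner _ h0 h1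
  refine ⟨g + single m 0 ψ, add_mem hg (single_mem_homogeneous rfl ψ), ?_⟩
  rw [map_add, diff_single, hψ0, hψ, map_zero, smul_zero, add_zero]
  have : f' = single (m + 1) 0 (f' (m + 1) 0) := by
    funext i j
    by_cases hc : i = m + 1 ∧ j = 0
    · obtain ⟨rfl, rfl⟩ := hc
      rw [single_same]
    · rw [single_of_ne _ (by omega)]
      by_cases hi : i < m + 1
      · exact hgf i hi j
      · exact hh i j (by omega)
  rw [← this, hf']
  abel

end HomGrid

end HomGrid

section Factor

variable {R : Type} [CommRing R] {A B C X Y : Type} [AddCommGroup A] [Module R A]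
  [AddCommGroup B] [Module R B] [AddCommGroup C] [Module R C] [AddCommGroup X] [Module R X]
  [AddCommGroup Y] [Module R Y]

theorem exists_comp_eq_of_exact_left {f : A →ₗ[R] B} {g : B →ₗ[R] C}
    (hf : Function.Injective f) (h : Function.Exact f g) (φ : X →ₗ[R] B) (hφ : g ∘ₗ φ = 0) :
    ∃ ψ : X →ₗ[R] A, f ∘ₗ ψ = φ := by
  have hmem : ∀ x, φ x ∈ LinearMap.range f := fun x => (h _).1 (LinearMap.congr_fun hφ x)
  refine ⟨(LinearEquiv.ofInjective f hf).symm ∘ₗ φ.codRestrict _ hmem, ?_⟩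
  ext x
  exact congrArg Subtype.val
    ((LinearEquiv.ofInjective f hf).apply_symm_apply (φ.codRestrict _ hmem x))

theorem exists_comp_eq_of_exact_right {f : A →ₗ[R] B} {g : B →ₗ[R] C}
    (hg : Function.Surjective g) (h : Function.Exact f g) (φ : B →ₗ[R] Y) (hφ : φ ∘ₗ f = 0) :
    ∃ ψ : C →ₗ[R] Y, ψ ∘ₗ g = φ := by
  have hker : LinearMap.ker g ≤ LinearMap.ker φ := by
    intro b hb
    obtain ⟨a, rfl⟩ := (h b).1 hb
    exact LinearMap.congr_fun hφ a
  refine ⟨(LinearMap.ker g).liftQ φ hker ∘ₗ (g.quotKerEquivOfSurjective hg).symm, ?_⟩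
  ext b
  have : (g.quotKerEquivOfSurjective hg).symm (g b) = Submodule.Quotient.mk b := by
    rw [LinearEquiv.symm_apply_eq]; rfl
  simp [this]

end Factor

section Socle

open IsLocalRing

variable {R : Type} [CommRing R] [IsLocalRing R] {A C P : Type} [AddCommGroup A] [Module R A]
  [AddCommGroup C] [Module R C] [AddCommGroup P] [Module R P]

/-- The map from the residue field determined by a socle element. -/
theorem exists_residue_map {y : P} (hy : ∀ x ∈ maximalIdeal R, x • y = 0) :
    ∃ φ : (R ⧸ maximalIdeal R) →ₗ[R] P, ∀ r : R, φ (Submodule.Quotient.mk r) = r • y :=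
  ⟨Submodule.liftQ _ (LinearMap.toSpanSingleton R P y) fun x hx => hy x hx, fun _ => rfl⟩

/-- A map with `Ext¹(k, ker) = 0` that kills the socle kills all `𝔪`-power torsion. -/
theorem ExtVanishes.map_eq_zero_of_socle {f : A →ₗ[R] C} {D : C →ₗ[R] P}
    (hf : Function.Injective f) (h : Function.Exact f D)
    (hA : ExtVanishes R 1 (R ⧸ maximalIdeal R) A)
    (hsoc : ∀ c, (∀ x ∈ maximalIdeal R, x • c = 0) → D c = 0) (n : ℕ) :
    ∀ c, (∀ x ∈ maximalIdeal R ^ n, x • c = 0) → D c = 0 := by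
  induction n with
  | zero =>
    intro c hc
    have := hc 1 (by simp)
    rw [one_smul] at this
    rw [this, map_zero]
  | succ n ih =>
    intro c hc
    have hexact : Function.Exact f D.rangeRestrict := fun b => by
      rw [← h b, ← LinearMap.mem_ker, LinearMap.ker_rangeRestrict, LinearMap.mem_ker]
    obtain ⟨φ, hφ⟩ := exists_residue_map (y := D.rangeRestrict c) fun x hx => by
      rw [← map_smul]
      refine Subtype.ext (ih _ fun z hz => ?_)
      rw [smul_smul]
      exact hc _ (by rw [pow_succ]; exact Ideal.mul_mem_mul hz hx)
    obtain ⟨ψ, hψ⟩ := hA.exists_lift hf hexact D.surjective_rangeRestrict φ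
    have h1 : D (ψ (Submodule.Quotient.mk 1)) = D c := by
      have := congrArg Subtype.val (LinearMap.congr_fun hψ (Submodule.Quotient.mk 1))
      rw [hφ, one_smul] at this
      exact this
    rw [← h1]
    refine hsoc _ fun x hx => ?_
    rw [← map_smul, ← Submodule.Quotient.mk_smul, smul_eq_mul, mul_one,
      (Submodule.Quotient.mk_eq_zero _).2 hx, map_zero]

/-- Nonzero elements of a Noetherian local ring are detected, modulo a power of the maximal
ideal, by maps to an injective module with nonzero socle. -/
theorem exists_map_apply_ne_zero [IsNoetherianRing R] {I : Type} [AddCommGroup I] [Module R I]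
    [Module.Injective R I] {ξ : I} (hξ : ξ ≠ 0) (hξm : ∀ x ∈ maximalIdeal R, x • ξ = 0)
    {w : R} (hw : w ≠ 0) :
    ∃ (n : ℕ) (φ : R →ₗ[R] I), (∀ x ∈ maximalIdeal R ^ n, φ x = 0) ∧ φ w ≠ 0 := by
  obtain ⟨n, hn⟩ : ∃ n, w ∉ maximalIdeal R ^ n := by
    by_contra! h
    have h1 : w ∈ ⨅ n : ℕ, maximalIdeal R ^ n := (Submodule.mem_iInf _).2 h
    rw [Ideal.iInf_pow_eq_bot_of_isLocalRing _ (maximalIdeal.isMaximal R).ne_top] at h1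
    exact hw h1
  let v : R ⧸ maximalIdeal R ^ n := Submodule.Quotient.mk w
  have hv : v ≠ 0 := fun h => hn ((Submodule.Quotient.mk_eq_zero _).1 h)
  let g : R →ₗ[R] (R ⧸ maximalIdeal R ^ n) := LinearMap.toSpanSingleton R _ v
  have hle : LinearMap.ker g ≤ LinearMap.ker (LinearMap.toSpanSingleton R I ξ) := by
    intro r hr
    refine hξm r ((mem_maximalIdeal _).2 fun hu => hv ?_)
    have hr' : r • v = 0 := hr
    exact (hu.smul_eq_zero).1 hr'
  obtain ⟨l, hl⟩ := Module.Injective.out ((LinearMap.ker g).liftQ g le_rfl)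
    (LinearMap.ker_eq_bot.1 (Submodule.ker_liftQ_eq_bot' _ _ rfl))
    ((LinearMap.ker g).liftQ _ hle)
  refine ⟨n, l ∘ₗ Submodule.mkQ _, fun x hx => ?_, ?_⟩
  · have : Submodule.mkQ (maximalIdeal R ^ n) x = 0 :=
      (Submodule.Quotient.mk_eq_zero _).2 hx
    rw [LinearMap.comp_apply, this, map_zero]
  · have := hl (Submodule.Quotient.mk 1)
    rw [Submodule.liftQ_apply, Submodule.liftQ_apply, LinearMap.toSpanSingleton_apply,
      LinearMap.toSpanSingleton_apply, one_smul, one_smul] at this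
    rw [LinearMap.comp_apply]
    exact fun h => hξ (this.symm.trans h)

end Socle

instance injective_linearMap_of_fin {R : Type} [CommRing R] (n : ℕ) (E : Type) [AddCommGroup E]
    [Module R E] [Module.Injective R E] : Module.Injective R ((Fin n → R) →ₗ[R] E) :=
  injective_of_retract (Module.piEquiv (Fin n) R E).symm.toLinearMap
    (Module.piEquiv (Fin n) R E).toLinearMap fun f => by simp

section Resolutions

open IsLocalRing

variable {R : Type} [CommRing R] [IsLocalRing R]

/-- A minimal injective resolution, with cosyzygies `J j`. -/
structure IsMinimalInjectiveResolution (J I : ℕ → ModuleCat.{0} R)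
    (ι : ∀ j, J j →ₗ[R] I j) (π : ∀ j, I j →ₗ[R] J (j + 1)) : Prop where
  injective j : Module.Injective R (I j)
  ι_injective j : Function.Injective (ι j)
  exact j : Function.Exact (ι j) (π j)
  π_surjective j : Function.Surjective (π j)
  map_socle j (z : I j) : (∀ x ∈ maximalIdeal R, x • z = 0) → π j z = 0

/-- A minimal free resolution by finite free modules, with syzygies `S i`. -/
structure IsMinimalFreeResolution (S : ℕ → ModuleCat.{0} R) (n : ℕ → ℕ)
    (κ : ∀ i, S (i + 1) →ₗ[R] (Fin (n i) → R)) (ρ : ∀ i, (Fin (n i) → R) →ₗ[R] S i) : Prop where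
  κ_injective i : Function.Injective (κ i)
  exact i : Function.Exact (κ i) (ρ i)
  ρ_surjective i : Function.Surjective (ρ i)
  mem_maximalIdeal i (v : S (i + 1)) (a : Fin (n i)) : κ i v a ∈ maximalIdeal R

namespace IsMinimalInjectiveResolution

variable {J I : ℕ → ModuleCat.{0} R} {ι : ∀ j, J j →ₗ[R] I j} {π : ∀ j, I j →ₗ[R] J (j + 1)}
  (hI : IsMinimalInjectiveResolution J I ι π)

include hI

theorem diff_comp_diff (j : ℕ) : (ι (j + 2) ∘ₗ π (j + 1)) ∘ₗ (ι (j + 1) ∘ₗ π j) = 0 := by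
  ext z
  simp [(hI.exact (j + 1)).apply_apply_eq_zero]

theorem exact_diff (j : ℕ) : Function.Exact (ι j) (ι (j + 1) ∘ₗ π j) := fun z => by
  rw [← hI.exact j z, LinearMap.comp_apply, map_eq_zero_iff _ (hI.ι_injective (j + 1))]

/-- Some term among the first `d + 1` of the resolution of a nonzero module has nonzero socle. -/
theorem exists_socle_ne_zero [IsNoetherianRing R] {d : ℕ} (hd : ringKrullDim R = d) {N : Type}
    [AddCommGroup N] [Module R N] [Module.Finite R N] [Nontrivial N] (e : N ≃ₗ[R] J 0) :
    ∃ t ≤ d, ∃ ξ : I t, ξ ≠ 0 ∧ ∀ x ∈ maximalIdeal R, x • ξ = 0 := by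
  by_contra! hsoc
  have key : ∀ a i, i + a ≤ d → ExtVanishes R a (R ⧸ maximalIdeal R) (J i) := by
    intro a
    induction a with
    | zero =>
      intro i hi
      refine extVanishes_zero_iff.2 fun φ => ?_
      by_contra hφ
      have h1 : φ (Submodule.Quotient.mk 1) ≠ 0 := fun h0 => hφ <| by
        ext
        exact h0
      obtain ⟨x, hx, hne⟩ := hsoc i hi (ι i (φ (Submodule.Quotient.mk 1)))
        (by rwa [Ne, map_eq_zero_iff _ (hI.ι_injective i)])
      refine hne ?_
      rw [← map_smul, ← map_smul, ← Submodule.Quotient.mk_smul, smul_eq_mul, mul_one,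
        (Submodule.Quotient.mk_eq_zero _).2 hx, map_zero, map_zero]
    | succ a ih =>
      intro i hi
      have := hI.injective i
      exact (ih (i + 1) (by omega)).target_left (hI.ι_injective i) (hI.exact i)
        (hI.π_surjective i) (extVanishes_succ_of_injective a)
  obtain ⟨j, hj, h⟩ := exists_not_extVanishes_residue hd N
  exact h ((key j 0 (by omega)).congr_target e.symm)

end IsMinimalInjectiveResolution

namespace IsMinimalFreeResolution

variable {S : ℕ → ModuleCat.{0} R} {n : ℕ → ℕ}
  {κ : ∀ i, S (i + 1) →ₗ[R] (Fin (n i) → R)} {ρ : ∀ i, (Fin (n i) → R) →ₗ[R] S i}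
  (hF : IsMinimalFreeResolution S n κ ρ)

include hF

theorem diff_comp_diff (i : ℕ) : (κ i ∘ₗ ρ (i + 1)) ∘ₗ (κ (i + 1) ∘ₗ ρ (i + 2)) = 0 := by
  ext z
  simp [(hF.exact (i + 1)).apply_apply_eq_zero]

theorem exact_diff (i : ℕ) : Function.Exact (κ i ∘ₗ ρ (i + 1)) (ρ i) := fun z => by
  rw [hF.exact i z]
  constructor
  · rintro ⟨y, rfl⟩
    obtain ⟨v, rfl⟩ := hF.ρ_surjective (i + 1) y
    exact ⟨v, rfl⟩
  · rintro ⟨v, rfl⟩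
    exact ⟨_, rfl⟩

theorem extVanishes_syzygy {N : Type} [AddCommGroup N] [Module R N] {d : ℕ}
    (hext : ∀ a, a < d → ExtVanishes R (a + 1) (S 0) N) (i : ℕ) :
    ∀ a, i + a < d → ExtVanishes R (a + 1) (S i) N := by
  induction i with
  | zero => exact fun a ha => hext a (by omega)
  | succ i ih =>
    exact fun a ha => (extVanishes_succ_of_projective a).left (hF.κ_injective i) (hF.exact i)
      (hF.ρ_surjective i) (ih (a + 1) (by omega))

end IsMinimalFreeResolution

end Resolutions

section HomComplex

open IsLocalRing HomGrid

variable {R : Type} [CommRing R] [IsLocalRing R]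
  {J I : ℕ → ModuleCat.{0} R} {ι : ∀ j, J j →ₗ[R] I j} {π : ∀ j, I j →ₗ[R] J (j + 1)}
  {S : ℕ → ModuleCat.{0} R} {n : ℕ → ℕ}
  {κ : ∀ i, S (i + 1) →ₗ[R] (Fin (n i) → R)} {ρ : ∀ i, (Fin (n i) → R) →ₗ[R] S i}

variable (ι π κ ρ) in
/-- Cocycles of degree `m` in the Hom complex from a free to an injective resolution. -/
abbrev homCocycles (m : ℕ) : Submodule R (HomGrid R (fun i => Fin (n i) → R) fun j => I j) :=
  cocycles (fun i => κ i ∘ₗ ρ (i + 1)) (fun j => ι (j + 1) ∘ₗ π j) m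

variable (hI : IsMinimalInjectiveResolution J I ι π) (hF : IsMinimalFreeResolution S n κ ρ)

include hI hF

/-- The corner of the Hom complex of total degree `m` that is a cocycle comes from a map between
the augmentations. -/
theorem exists_eq_comp_of_corner (m : ℕ) (φ : (Fin (n m) → R) →ₗ[R] I 0)
    (h1 : (ι 1 ∘ₗ π 0) ∘ₗ φ = 0) (h2 : φ ∘ₗ (κ m ∘ₗ ρ (m + 1)) = 0) :
    ∃ ψ : S m →ₗ[R] J 0, ι 0 ∘ₗ ψ ∘ₗ ρ m = φ := by
  obtain ⟨χ, rfl⟩ := exists_comp_eq_of_exact_left (hI.ι_injective 0) (hI.exact_diff 0) φ h1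
  obtain ⟨ψ, rfl⟩ := exists_comp_eq_of_exact_right (hF.ρ_surjective m) (hF.exact_diff m) χ <| by
    ext v
    exact hI.ι_injective 0 ((LinearMap.congr_fun h2 _).trans (map_zero _).symm)
  exact ⟨ψ, rfl⟩

/-- Degree-zero cocycles of the Hom complex are the maps between the resolved modules. -/
theorem nonempty_equiv_homCocycles_zero :
    Nonempty ((S 0 →ₗ[R] J 0) ≃ₗ[R] homCocycles ι π κ ρ 0) := by
  let Φ : (S 0 →ₗ[R] J 0) →ₗ[R] HomGrid R (fun i => Fin (n i) → R) fun j => I j :=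
    single 0 0 ∘ₗ (ι 0).compRight R ∘ₗ (ρ 0).lcomp R (J 0)
  have hΦ : ∀ φ, Φ φ = single 0 0 (ι 0 ∘ₗ φ ∘ₗ ρ 0) := fun φ => rfl
  have hmem : ∀ φ, Φ φ ∈ homCocycles ι π κ ρ 0 := by
    refine fun φ => ⟨by
      change Φ φ ∈ homogeneous R (fun i => Fin (n i) → R) (fun j => I j) 0
      rw [hΦ]
      exact single_mem_homogeneous
        (F := fun i => Fin (n i) → R) (E := fun j => I j) (i := 0) (j := 0) (zero_add 0) _, ?_⟩
    have h1 : (ι 0 ∘ₗ φ ∘ₗ ρ 0) ∘ₗ (κ 0 ∘ₗ ρ 1) = 0 := by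
      ext v
      simp [(hF.exact 0).apply_apply_eq_zero]
    have h2 : (ι 1 ∘ₗ π 0) ∘ₗ (ι 0 ∘ₗ φ ∘ₗ ρ 0) = 0 := by
      ext v
      simp [(hI.exact 0).apply_apply_eq_zero]
    change diff _ _ (Φ φ) = 0
    rw [hΦ, diff_single, h1, h2, map_zero, map_zero, smul_zero, add_zero]
  refine ⟨LinearEquiv.ofBijective (Φ.codRestrict _ hmem) ⟨?_, ?_⟩⟩
  · intro φ ψ h
    have h1 : Φ φ = Φ ψ := congrArg Subtype.val h
    rw [hΦ, hΦ] at h1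
    have h2 := congrFun (congrFun h1 0) 0
    rw [single_same, single_same] at h2
    ext v
    obtain ⟨y, rfl⟩ := hF.ρ_surjective 0 v
    exact hI.ι_injective 0 (LinearMap.congr_fun h2 y)
  · rintro ⟨f, hf, hd⟩
    have hd' : diff (fun i => κ i ∘ₗ ρ (i + 1)) (fun j => ι (j + 1) ∘ₗ π j) f = 0 := hd
    obtain ⟨ψ, hψ⟩ := exists_eq_comp_of_corner hI hF 0 (f 0 0)
      ((diff_zero_succ _ _ f 0).symm.trans (by rw [hd']))
      ((diff_succ_zero _ _ f 0).symm.trans (by rw [hd']))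
    refine ⟨ψ, Subtype.ext ?_⟩
    change single 0 0 (ι 0 ∘ₗ ψ ∘ₗ ρ 0) = f
    rw [hψ]
    funext i j
    by_cases hc : i = 0 ∧ j = 0
    · obtain ⟨rfl, rfl⟩ := hc
      rw [single_same]
    · rw [single_of_ne _ (by omega), hf i j (by omega)]

theorem exists_diff_eq_of_extVanishes {m : ℕ} (hext : ExtVanishes R 1 (S m) (J 0))
    {f : HomGrid R (fun i => Fin (n i) → R) fun j => I j} (hf : f ∈ homCocycles ι π κ ρ (m + 1)) :
    ∃ g ∈ homogeneous R (fun i => Fin (n i) → R) (fun j => I j) m,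
      diff (fun i => κ i ∘ₗ ρ (i + 1)) (fun j => ι (j + 1) ∘ₗ π j) g = f := by
  refine exists_diff_eq (fun i => hF.diff_comp_diff i) (fun j => hI.diff_comp_diff j) ?_ ?_ hf
  · intro i j φ hφ
    obtain ⟨χ, rfl⟩ := exists_comp_eq_of_exact_left (hI.ι_injective (j + 1))
      (hI.exact_diff (j + 1)) φ hφ
    obtain ⟨ψ, rfl⟩ := Module.projective_lifting_property (π j) χ (hI.π_surjective j)
    exact ⟨ψ, rfl⟩
  · intro φ h1 h2
    obtain ⟨χ, rfl⟩ := exists_eq_comp_of_corner hI hF (m + 1) φ h1 h2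
    obtain ⟨ψ, rfl⟩ := hext.exists_extend (hF.κ_injective m) (hF.exact m) (hF.ρ_surjective m) χ
    refine ⟨ι 0 ∘ₗ ψ, ?_, rfl⟩
    ext v
    simp [(hI.exact 0).apply_apply_eq_zero]

theorem extVanishes_homCocycles {d : ℕ} (hext : ∀ m < d, ExtVanishes R 1 (S m) (J 0)) {X : Type}
    [AddCommGroup X] [Module R X] (h0 : ExtVanishes R (d + 1) X (S 0 →ₗ[R] J 0)) :
    ExtVanishes R 1 X (homCocycles ι π κ ρ d) := by
  have := hI.injective
  have key : ∀ m l, m + l = d → ExtVanishes R (l + 1) X (homCocycles ι π κ ρ m) := by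
    intro m
    induction m with
    | zero =>
      intro l hl
      obtain rfl : l = d := by omega
      exact h0.congr_target (nonempty_equiv_homCocycles_zero hI hF).some
    | succ m ih =>
      intro l hl
      let D := diff (fun i => κ i ∘ₗ ρ (i + 1)) (fun j => ι (j + 1) ∘ₗ π j)
      have hD : ∀ g ∈ homogeneous R (fun i => Fin (n i) → R) (fun j => I j) m,
          D g ∈ homCocycles ι π κ ρ (m + 1) := fun g hg =>
        ⟨diff_mem_homogeneous _ _ hg,
          diff_diff (fun i => hF.diff_comp_diff i) (fun j => hI.diff_comp_diff j) g⟩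
      have := injective_homogeneous (R := R) (F := fun i => Fin (n i) → R) (E := fun j => I j) m
      refine ExtVanishes.target_right (f := Submodule.inclusion inf_le_left)
        (g := D.restrict hD) (Submodule.inclusion_injective _) ?_ ?_
        (extVanishes_succ_of_injective l) (ih (l + 1) (by omega))
      · intro g
        constructor
        · exact fun h => ⟨⟨g.1, g.2, congrArg Subtype.val h⟩, rfl⟩
        · rintro ⟨f, rfl⟩
          exact Subtype.ext f.2.2
      · rintro ⟨f, hf⟩
        obtain ⟨g, hg, hgf⟩ := exists_diff_eq_of_extVanishes hI hF (hext m (by omega)) hf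
        exact ⟨⟨g, hg⟩, Subtype.ext hgf⟩
  exact key d 0 (by omega)

theorem diff_eq_zero_of_socle (f : HomGrid R (fun i => Fin (n i) → R) fun j => I j)
    (hf : ∀ x ∈ maximalIdeal R, x • f = 0) :
    diff (fun i => κ i ∘ₗ ρ (i + 1)) (fun j => ι (j + 1) ∘ₗ π j) f = 0 := by
  have hx : ∀ i j v, ∀ x ∈ maximalIdeal R, x • f i j v = 0 := fun i j v x hx =>
    LinearMap.congr_fun (congrFun (congrFun (hf x hx) i) j) v
  have h1 : ∀ i j, f i j ∘ₗ (κ i ∘ₗ ρ (i + 1)) = 0 := by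
    intro i j
    refine LinearMap.ext fun v => ?_
    change f i j (κ i (ρ (i + 1) v)) = 0
    rw [pi_eq_sum_univ' (κ i (ρ (i + 1) v)), map_sum]
    refine Finset.sum_eq_zero fun a _ => ?_
    rw [map_smul]
    exact hx i j _ _ (hF.mem_maximalIdeal i _ a)
  have h2 : ∀ i j, (ι (j + 1) ∘ₗ π j) ∘ₗ f i j = 0 := by
    intro i j
    refine LinearMap.ext fun v => ?_
    change ι (j + 1) (π j (f i j v)) = 0
    rw [hI.map_socle j _ (hx i j v), map_zero]
  funext i j
  rcases i with _ | i <;> rcases j with _ | j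
  · exact diff_zero_zero _ _ f
  · rw [diff_zero_succ, h2]; rfl
  · rw [diff_succ_zero, h1]; rfl
  · rw [diff_succ_succ, h1, h2, smul_zero, add_zero]; rfl

/-- If `Ext¹(k, -)` of the degree `s + t` cocycles vanishes and the injective term in degree `t`
has nonzero socle, then the free resolution stops in degree `s`. -/
theorem subsingleton_syzygy_of_extVanishes [IsNoetherianRing R] {s t : ℕ}
    (hext : ExtVanishes R 1 (R ⧸ maximalIdeal R) (homCocycles ι π κ ρ (s + t))) {ξ : I t}
    (hξ : ξ ≠ 0) (hξm : ∀ x ∈ maximalIdeal R, x • ξ = 0) : Subsingleton (S (s + 1)) := by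
  refine subsingleton_of_forall_eq 0 fun u => ?_
  by_contra hu
  have hw : κ s u ≠ 0 := by rwa [Ne, map_eq_zero_iff _ (hF.κ_injective s)]
  obtain ⟨a, ha⟩ := Function.ne_iff.1 hw
  have := hI.injective t
  obtain ⟨N, φ, hφ, hφw⟩ := exists_map_apply_ne_zero hξ hξm ha
  let h : (Fin (n s) → R) →ₗ[R] I t := φ ∘ₗ LinearMap.proj a
  let D := diff (fun i => κ i ∘ₗ ρ (i + 1)) (fun j => ι (j + 1) ∘ₗ π j)
  let g : HomGrid R (fun i => Fin (n i) → R) fun j => I j := single s t h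
  let f : homogeneous R (fun i => Fin (n i) → R) (fun j => I j) (s + t) :=
    ⟨g, single_mem_homogeneous
      (F := fun i => Fin (n i) → R) (E := fun j => I j) (i := s) (j := t) rfl h⟩
  have hD : (D ∘ₗ Submodule.subtype _) f = 0 := by
    refine hext.map_eq_zero_of_socle (f := Submodule.inclusion inf_le_left)
      (D := D ∘ₗ Submodule.subtype _) (Submodule.inclusion_injective _) ?_ ?_ N f ?_
    · intro g
      constructor
      · exact fun h => ⟨⟨g.1, g.2, h⟩, rfl⟩
      · rintro ⟨f, rfl⟩
        exact f.2.2
    · exact fun c hc => diff_eq_zero_of_socle hI hF c.1 fun x hx => congrArg Subtype.val (hc x hx)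
    · intro x hx
      refine Subtype.ext ?_
      change x • g = 0
      have : x • h = 0 := LinearMap.ext fun v => by
        change x • φ (v a) = 0
        rw [← map_smul]
        exact hφ _ (Ideal.mul_mem_right _ _ hx)
      simp only [g]
      rw [← map_smul, this, map_zero]
  have hD' : D g = 0 := hD
  have h1 : h ∘ₗ (κ s ∘ₗ ρ (s + 1)) = 0 := by
    have := congrFun (congrFun hD' (s + 1)) t
    simp only [D, g] at this
    rw [diff_single, Pi.add_apply, Pi.add_apply, Pi.smul_apply, Pi.smul_apply, single_same,
      single_of_ne _ (Or.inl (by omega)), smul_zero, add_zero] at this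
    exact this
  obtain ⟨v, rfl⟩ := hF.ρ_surjective (s + 1) u
  exact hφw (LinearMap.congr_fun h1 v)

end HomComplex

section Conclusion

open IsLocalRing

theorem ExtVanishes.target_of_retract {R : Type} [CommRing R] {A B X : Type} [AddCommGroup A]
    [Module R A] [AddCommGroup B] [Module R B] [AddCommGroup X] [Module R X] {i : ℕ}
    (f : A →ₗ[R] B) (g : B →ₗ[R] A) (h : g ∘ₗ f = LinearMap.id) (hB : ExtVanishes R i X B) :
    ExtVanishes R i X A := by
  refine extVanishes_of_forall_eq_zero fun x => ?_
  have h1 : ModuleCat.ofHom f ≫ ModuleCat.ofHom g = 𝟙 _ := by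
    rw [← ModuleCat.ofHom_comp, h]; rfl
  have h2 := hB.eq_zero (x.comp (Abelian.Ext.mk₀ (ModuleCat.ofHom f)) (add_zero i))
  rw [← Abelian.Ext.comp_mk₀_id x, ← h1, ← Abelian.Ext.mk₀_comp_mk₀,
    ← Abelian.Ext.comp_assoc_of_third_deg_zero, h2, Abelian.Ext.zero_comp]

theorem HasFiniteInjDim.of_linearMap_of_free {R : Type} [CommRing R] {M N : Type}
    [AddCommGroup M] [Module R M] [AddCommGroup N] [Module R N] [Module.Free R M] [Nontrivial M]
    (h : HasFiniteInjDim R (M →ₗ[R] N)) : HasFiniteInjDim R N := by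
  obtain ⟨r, hr⟩ := h
  let b := Module.Free.chooseBasis R M
  have := Module.nontrivial R M
  obtain ⟨a⟩ : Nonempty (Module.Free.ChooseBasisIndex R M) := b.index_nonempty
  refine ⟨r, fun X _ _ i hi => ?_⟩
  obtain ⟨j, rfl⟩ : ∃ j, i = j + 1 := ⟨i - 1, by omega⟩
  refine (subsingleton_extMod_succ_iff j).2 <|
    ((subsingleton_extMod_succ_iff j).1 (hr X (j + 1) hi)).target_of_retract
      (LinearMap.smulRightₗ (b.coord a)) (LinearMap.applyₗ (b a)) ?_
  ext y
  simp

variable {R : Type} [CommRing R] [IsLocalRing R]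

namespace IsMinimalFreeResolution

variable {S : ℕ → ModuleCat.{0} R} {n : ℕ → ℕ}
  {κ : ∀ i, S (i + 1) →ₗ[R] (Fin (n i) → R)} {ρ : ∀ i, (Fin (n i) → R) →ₗ[R] S i}
  (hF : IsMinimalFreeResolution S n κ ρ)

include hF

theorem bijective_of_subsingleton (i : ℕ) [Subsingleton (S (i + 1))] :
    Function.Bijective (ρ i) := by
  refine ⟨(injective_iff_map_eq_zero _).2 fun v hv => ?_, hF.ρ_surjective i⟩
  obtain ⟨u, rfl⟩ := (hF.exact i v).1 hv
  rw [Subsingleton.elim u 0, map_zero]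

theorem subsingleton_syzygy_of_succ {N : Type} [AddCommGroup N] [Module R N] [Module.Finite R N]
    [Nontrivial N] {i : ℕ} (hext : ExtVanishes R 1 (S i) N) [Subsingleton (S (i + 2))] :
    Subsingleton (S (i + 1)) := by
  by_contra hS
  have hbij := hF.bijective_of_subsingleton (i + 1)
  let e := LinearEquiv.ofBijective (ρ (i + 1)) hbij
  have hn : Nonempty (Fin (n (i + 1))) := by
    by_contra! hn
    exact hS e.symm.injective.subsingleton
  obtain ⟨a⟩ := hn
  obtain ⟨y, hy⟩ : ∃ y : N, y ∉ maximalIdeal R • (⊤ : Submodule R N) := by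
    by_contra! h
    exact Submodule.top_ne_ideal_smul_of_le_jacobson_annihilator
      (maximalIdeal_le_jacobson _) (eq_top_iff.2 fun y _ => h y).symm
  obtain ⟨ψ, hψ⟩ := hext.exists_extend (hF.κ_injective i) (hF.exact i) (hF.ρ_surjective i)
    (LinearMap.toSpanSingleton R N y ∘ₗ LinearMap.proj a ∘ₗ e.symm.toLinearMap)
  have h1 : ψ (κ i (e (Pi.single a 1))) = y := by
    have := LinearMap.congr_fun hψ (e (Pi.single a 1))
    simpa using this
  refine hy ?_
  rw [← h1, pi_eq_sum_univ' (κ i (e (Pi.single a 1))), map_sum]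
  refine Submodule.sum_mem _ fun c _ => ?_
  rw [map_smul]
  exact Submodule.smul_mem_smul (hF.mem_maximalIdeal i _ c) Submodule.mem_top

theorem subsingleton_syzygy_one {N : Type} [AddCommGroup N] [Module R N] [Module.Finite R N]
    [Nontrivial N] {d : ℕ} (hext : ∀ i < d, ExtVanishes R 1 (S i) N) (s : ℕ) (hs : s ≤ d)
    (hS : Subsingleton (S (s + 1))) : Subsingleton (S 1) := by
  induction s with
  | zero => exact hS
  | succ s ih => exact ih (by omega) (hF.subsingleton_syzygy_of_succ (hext s (by omega)))

end IsMinimalFreeResolution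

end Conclusion

theorem free_of_tor_rigid_target
    (R : Type) [CommRing R] [IsNoetherianRing R] [IsLocalRing R]
    (d : ℕ) (hd : ringKrullDim R = d)
    (M N : Type) [AddCommGroup M] [Module R M] [AddCommGroup N] [Module R N]
    [Module.Finite R M] [Module.Finite R N] [Nontrivial M] [Nontrivial N]
    (hrigid : IsTorRigid R N)
    (hinj : HasFiniteInjDim R (M →ₗ[R] N))
    (hext : ∀ i : ℕ, 1 ≤ i → i ≤ d → Subsingleton (extMod R i M N)) :
    Module.Free R M ∧ HasFiniteInjDim R N := by
  obtain ⟨J, I, eN, ι, π, hres⟩ := exists_minimal_injective_resolution (R := R) N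
  have hI : IsMinimalInjectiveResolution J I ι π := ⟨fun j => (hres j).1, fun j => (hres j).2.1,
    fun j => (hres j).2.2.1, fun j => (hres j).2.2.2.1, fun j => (hres j).2.2.2.2⟩
  obtain ⟨S, n, eM, κ, ρ, hfree⟩ := exists_minimal_free_resolution (R := R) M
  have hF : IsMinimalFreeResolution S n κ ρ := ⟨fun i => (hfree i).2.1, fun i => (hfree i).2.2.1,
    fun i => (hfree i).2.2.2.1, fun i => (hfree i).2.2.2.2⟩
  have hS : ∀ i < d, ExtVanishes R 1 (S i) N := fun i hi =>
    hF.extVanishes_syzygy (d := d) (fun a ha => ExtVanishes.congr_source eM <|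
      (subsingleton_extMod_succ_iff a).1 (hext (a + 1) (by omega) (by omega))) i 0 (by omega)
  have hT : ExtVanishes R (d + 1) (R ⧸ IsLocalRing.maximalIdeal R) (M →ₗ[R] N) := by
    obtain ⟨r, hr⟩ := hinj
    refine extVanishes_residue_of_ringKrullDim_lt hd r (fun i hi => ?_) (d + 1) (by omega)
    obtain ⟨j, rfl⟩ : ∃ j, i = j + 1 := ⟨i - 1, by omega⟩
    exact (subsingleton_extMod_succ_iff j).1 (hr _ (j + 1) hi)
  obtain ⟨t, ht, ξ, hξ, hξm⟩ := hI.exists_socle_ne_zero hd eN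
  obtain ⟨s, rfl⟩ : ∃ s, d = s + t := ⟨d - t, by omega⟩
  have hZ := extVanishes_homCocycles hI hF (fun m hm => (hS m hm).congr_target eN)
    (hT.congr_target (LinearEquiv.arrowCongr eM eN))
  have := hF.subsingleton_syzygy_one hS s (by omega)
    (subsingleton_syzygy_of_extVanishes hI hF hZ hξ hξm)
  have hM : Module.Free R M := Module.Free.of_equiv
    ((LinearEquiv.ofBijective (ρ 0) (hF.bijective_of_subsingleton 0)).trans eM.symm)
  exact ⟨hM, hinj.of_linearMap_of_free⟩
end
end

section
/- Let R be a commutative Noetherian local ring, C a semidualizing R-module, and M, N finitely generated R-modules such that both Hom_R(M,N) and N belong to the Auslander class A_C(R). Then the natural map Φ_M : C ⊗_R Hom_R(M,N) → Hom_R(M, C ⊗_R N), sending c ⊗ φ to the homomorphism m ↦ c ⊗ φ(m), is an isomorphism. -/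
open CategoryTheory

noncomputable section

/-- If `Ext¹(X, A) = 0` and `0 → A → B → L → 0` is exact, then every morphism `X ⟶ L` lifts
to `B`. -/
lemma exists_comp_eq_of_ext_one_eq_zero {R : Type} [CommRing R] {X : ModuleCat.{0} R}
    {S : ShortComplex (ModuleCat.{0} R)} (hS : S.ShortExact)
    (hX : Subsingleton (((Ext R (ModuleCat R) 1).obj (Opposite.op X)).obj S.X₁))
    (φ : X ⟶ S.X₃) : ∃ ψ : X ⟶ S.X₂, ψ ≫ S.g = φ := by
  have := hS.mono_f
  have := hS.epi_g
  let P := projectiveResolution X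
  have hzero : Limits.IsZero ((P.complex.linearYonedaObj R S.X₁).homology 1) :=
    (ModuleCat.isZero_of_subsingleton _).of_iso (P.isoExt 1 S.X₁).symm
  rw [← HomologicalComplex.exactAt_iff_isZero_homology,
    HomologicalComplex.exactAt_iff' _ 0 1 2 (by simp) (by simp),
    ShortComplex.moduleCat_exact_iff] at hzero
  let π₀ : P.complex.X 0 ⟶ X := P.π.f 0
  have : Epi π₀ := inferInstanceAs (Epi (P.π.f 0))
  have hπ : P.complex.d 1 0 ≫ π₀ = 0 := P.complex_d_comp_π_f_zero
  let h : P.complex.X 0 ⟶ S.X₂ := Projective.factorThru (π₀ ≫ φ) S.g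
  have hh : h ≫ S.g = π₀ ≫ φ := Projective.factorThru_comp _ _
  have hd : (P.complex.d 1 0 ≫ h) ≫ S.g = 0 := by
    rw [Category.assoc, hh, ← Category.assoc, hπ, Limits.zero_comp]
  let k : P.complex.X 1 ⟶ S.X₁ := hS.exact.lift (P.complex.d 1 0 ≫ h) hd
  have hk : k ≫ S.f = P.complex.d 1 0 ≫ h := hS.exact.lift_f _ _
  have hdk : P.complex.d 2 1 ≫ k = 0 := by
    rw [← cancel_mono S.f, Category.assoc, hk]
    simp
  obtain ⟨l, hl⟩ : ∃ l : P.complex.X 0 ⟶ S.X₁, P.complex.d 1 0 ≫ l = k := hzero k hdk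
  have hdesc : P.complex.d 1 0 ≫ (h - l ≫ S.f) = 0 := by
    rw [Preadditive.comp_sub, ← Category.assoc, hl, hk, sub_self]
  obtain ⟨ψ, hψ⟩ : ∃ ψ : X ⟶ S.X₂, π₀ ≫ ψ = h - l ≫ S.f :=
    ⟨_, (Limits.CokernelCofork.IsColimit.desc' P.isColimitCokernelCofork _ hdesc).2⟩
  refine ⟨ψ, ?_⟩
  rw [← cancel_epi π₀, ← Category.assoc, hψ, Preadditive.sub_comp, Category.assoc,
    S.zero, Limits.comp_zero, sub_zero, hh]

/-- If `Ext¹(C, A) = 0` and `f : A → B` is injective, then every linear map `C → B ⧸ f(A)` lifts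
to `B`. -/
lemma exists_mkQ_comp_eq_of_extMod_one {R : Type} [CommRing R] {C A B : Type} [AddCommGroup C]
    [Module R C] [AddCommGroup A] [Module R A] [AddCommGroup B] [Module R B]
    (hC : Subsingleton (extMod R 1 C A)) (f : A →ₗ[R] B) (hf : Function.Injective f)
    (φ : C →ₗ[R] B ⧸ LinearMap.range f) :
    ∃ ψ : C →ₗ[R] B, (LinearMap.range f).mkQ ∘ₗ ψ = φ := by
  let S : ShortComplex (ModuleCat.{0} R) := ShortComplex.moduleCatMk f (LinearMap.range f).mkQ
    (LinearMap.range_mkQ_comp f)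
  have hS : S.ShortExact := ModuleCat.shortComplex_shortExact S
    (LinearMap.exact_map_mkQ_range f) hf (Submodule.mkQ_surjective _)
  obtain ⟨ψ, hψ⟩ := exists_comp_eq_of_ext_one_eq_zero (X := ModuleCat.of R C) hS hC
    (ModuleCat.ofHom φ)
  exact ⟨ψ.hom, congrArg ModuleCat.Hom.hom hψ⟩

/-- Over a Noetherian ring, the functor `Hom(C, -)` detects the vanishing of finitely generated
modules when `C` is finitely generated and faithful. -/
lemma subsingleton_of_subsingleton_linearMap {R : Type} [CommRing R] [IsNoetherianRing R]
    {C K : Type} [AddCommGroup C] [Module R C] [Module.Finite R C] [AddCommGroup K] [Module R K]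
    [Module.Finite R K] (hC : Function.Injective (LinearMap.lsmul R C))
    (h : Subsingleton (C →ₗ[R] K)) : Subsingleton K := by
  obtain ⟨r, hr, hreg⟩ := IsSMulRegular.subsingleton_linearMap_iff.mp h
  have hr0 : r = 0 := hC <| by
    ext c
    simpa using Module.mem_annihilator.mp hr c
  subst hr0
  exact ⟨fun x y => hreg (by simp)⟩

/-- A linear map `f` of finitely generated modules over a Noetherian ring is bijective if
`Hom(C, f)` is, for `C` finitely generated and faithful with `Ext¹(C, A) = 0`. -/
lemma bijective_of_bijective_compRight {R : Type} [CommRing R] [IsNoetherianRing R]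
    {C A B : Type} [AddCommGroup C] [Module R C] [Module.Finite R C] [AddCommGroup A] [Module R A]
    [Module.Finite R A] [AddCommGroup B] [Module R B] [Module.Finite R B]
    (hC : Function.Injective (LinearMap.lsmul R C)) (hA : Subsingleton (extMod R 1 C A))
    (f : A →ₗ[R] B) (hf : Function.Bijective fun g : C →ₗ[R] A => f ∘ₗ g) :
    Function.Bijective f := by
  have hinj : Function.Injective f := by
    have : Subsingleton (C →ₗ[R] LinearMap.ker f) := ⟨fun g₁ g₂ => by
      have h : (LinearMap.ker f).subtype ∘ₗ g₁ = (LinearMap.ker f).subtype ∘ₗ g₂ := hf.1 <| by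
        ext c
        simp
      ext c
      exact LinearMap.congr_fun h c⟩
    have := subsingleton_of_subsingleton_linearMap hC this
    exact LinearMap.ker_eq_bot.mp ((LinearMap.ker f).subsingleton_iff_eq_bot.mp this)
  refine ⟨hinj, ?_⟩
  have : Subsingleton (C →ₗ[R] B ⧸ LinearMap.range f) := subsingleton_of_forall_eq 0 fun φ => by
    obtain ⟨ψ, rfl⟩ := exists_mkQ_comp_eq_of_extMod_one hA f hinj φ
    obtain ⟨g, rfl⟩ := hf.2 ψ
    ext c
    simp
  have := subsingleton_of_subsingleton_linearMap hC this
  exact LinearMap.range_eq_top.mp (Submodule.Quotient.subsingleton_iff.mp this)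

/-- Applying `Hom(C, -)` to `homTensorMap` gives an isomorphism when the unit maps of
`Hom(M, N)` and `N` are isomorphisms. -/
lemma bijective_homTensorMap_comp {R : Type} [CommRing R] {C M N : Type} [AddCommGroup C]
    [Module R C] [AddCommGroup M] [Module R M] [AddCommGroup N] [Module R N]
    (hHom : Function.Bijective (TensorProduct.mk R C (M →ₗ[R] N)).flip)
    (hN : Function.Bijective (TensorProduct.mk R C N).flip) :
    Function.Bijective fun g : C →ₗ[R] TensorProduct R C (M →ₗ[R] N) =>
      homTensorMap R C M N ∘ₗ g := by
  let e := LinearEquiv.ofBijective _ hN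
  have hcomp : (fun φ : M →ₗ[R] N =>
      homTensorMap R C M N ∘ₗ (TensorProduct.mk R C (M →ₗ[R] N)).flip φ) =
      fun φ => (e.toLinearMap ∘ₗ φ).flip := rfl
  refine (Function.Bijective.of_comp_iff _ hHom).mp ?_
  change Function.Bijective fun φ : M →ₗ[R] N =>
      homTensorMap R C M N ∘ₗ (TensorProduct.mk R C (M →ₗ[R] N)).flip φ
  rw [hcomp]
  exact ((LinearEquiv.congrRight e).trans LinearMap.lflip).bijective

theorem tensor_hom_iso_of_auslander_class
    (R : Type) [CommRing R] [IsNoetherianRing R] [IsLocalRing R]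
    (C : Type) [AddCommGroup C] [Module R C] [Module.Finite R C]
    (hC : IsSemidualizing R C)
    (M N : Type) [AddCommGroup M] [Module R M] [AddCommGroup N] [Module R N]
    [Module.Finite R M] [Module.Finite R N]
    (hHom : MemAuslanderClass R C (M →ₗ[R] N))
    (hN : MemAuslanderClass R C N) :
    Function.Bijective (homTensorMap R C M N) := by
  exact bijective_of_bijective_compRight hC.bijective.1 (hHom.ext_vanish 1 le_rfl) _
    (bijective_homTensorMap_comp hHom.bijective hN.bijective)
end
end

section
/- Let R be a commutative Noetherian local ring, C a semidualizing R-module, t a nonnegative integer, and M, N finitely generated R-modules such that both Hom_R(M,N) and N belong to the Auslander class A_C(R). If Ext_R^i(M,N) = 0 for all 1 ≤ i ≤ t, then Ext_R^i(M, C ⊗_R N) = 0 for all 1 ≤ i ≤ t. -/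
open CategoryTheory

noncomputable section

open TensorProduct

section Ext

variable {R : Type} [CommRing R]

lemma subsingleton_ext_iff_of_projectiveResolution {X Y : ModuleCat R}
    (P : ProjectiveResolution X) (n : ℕ) :
    Subsingleton (Abelian.Ext X Y (n + 1)) ↔
      ∀ f : P.complex.X (n + 1) ⟶ Y, P.complex.d (n + 2) (n + 1) ≫ f = 0 →
        ∃ g : P.complex.X n ⟶ Y, P.complex.d (n + 1) n ≫ g = f := by
  constructor
  · intro _ f hf
    exact (P.extMk_eq_zero_iff f (n + 2) rfl hf n rfl).mp (Subsingleton.elim _ _)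
  · intro h
    refine subsingleton_of_forall_eq 0 fun α ↦ ?_
    obtain ⟨f, hf, rfl⟩ := P.extMk_surjective α (n + 2) rfl
    exact (P.extMk_eq_zero_iff f (n + 2) rfl hf n rfl).mpr (h f hf)

lemma subsingleton_extMod_succ_iff_s8 (n : ℕ) (M N : Type) [AddCommGroup M] [Module R M]
    [AddCommGroup N] [Module R N] :
    Subsingleton (extMod R (n + 1) M N) ↔
      Subsingleton (Abelian.Ext (ModuleCat.of R M) (ModuleCat.of R N) (n + 1)) := by
  let P := ProjectiveResolution.of (ModuleCat.of R M)
  rw [subsingleton_ext_iff_of_projectiveResolution P, extMod,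
    (P.isoExt (R := R) (n + 1) (ModuleCat.of R N)).toLinearEquiv.toEquiv.subsingleton_congr,
    ← ModuleCat.isZero_iff_subsingleton, ← HomologicalComplex.exactAt_iff_isZero_homology,
    HomologicalComplex.exactAt_iff' _ n (n + 1) (n + 2) (by simp) (by simp),
    ShortComplex.moduleCat_exact_iff]
  rfl

lemma subsingleton_ext_of_linearEquiv_pi {ι : Type} {C X Y : Type} [AddCommGroup C] [Module R C]
    [AddCommGroup X] [Module R X] [AddCommGroup Y] [Module R Y] (e : Y ≃ₗ[R] (ι → X)) (n : ℕ)
    (h : Subsingleton (Abelian.Ext (ModuleCat.of R C) (ModuleCat.of R X) (n + 1))) :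
    Subsingleton (Abelian.Ext (ModuleCat.of R C) (ModuleCat.of R Y) (n + 1)) := by
  let P := ProjectiveResolution.of (ModuleCat.of R C)
  rw [subsingleton_ext_iff_of_projectiveResolution P] at h ⊢
  intro f hf
  choose g hg using fun i ↦ h (f ≫ ModuleCat.ofHom (LinearMap.proj i ∘ₗ e.toLinearMap))
    (by rw [← Category.assoc, hf, Limits.zero_comp])
  refine ⟨ModuleCat.ofHom (e.symm.toLinearMap ∘ₗ LinearMap.pi fun i ↦ (g i).hom), ?_⟩
  ext x
  apply e.injective
  ext i
  simpa using congr($(hg i) x)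

variable {A B D X : Type} [AddCommGroup A] [Module R A] [AddCommGroup B] [Module R B]
  [AddCommGroup D] [Module R D] [AddCommGroup X] [Module R X]
  {i : A →ₗ[R] B} {p : B →ₗ[R] D}

lemma shortExact_ofHom (hi : Function.Injective i) (hip : Function.Exact i p)
    (hp : Function.Surjective p) :
    (ShortComplex.mk (ModuleCat.ofHom i) (ModuleCat.ofHom p) (by
      ext x; exact hip.apply_apply_eq_zero x)).ShortExact where
  exact := by
    rw [ShortComplex.moduleCat_exact_iff]
    exact fun x hx ↦ (hip x).mp hx
  mono_f := (ModuleCat.mono_iff_injective _).mpr hi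
  epi_g := (ModuleCat.epi_iff_surjective _).mpr hp

lemma exists_lift_of_subsingleton_ext_one (hi : Function.Injective i) (hip : Function.Exact i p)
    (hp : Function.Surjective p)
    (hX : Subsingleton (Abelian.Ext (ModuleCat.of R X) (ModuleCat.of R A) 1)) (f : X →ₗ[R] D) :
    ∃ g : X →ₗ[R] B, p ∘ₗ g = f := by
  obtain ⟨x, hx⟩ := Abelian.Ext.covariant_sequence_exact₃ (ModuleCat.of R X)
    (shortExact_ofHom hi hip hp) (Abelian.Ext.mk₀ (ModuleCat.ofHom f)) (zero_add 1)
    (Subsingleton.elim (h := hX) _ _)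
  obtain ⟨g, rfl⟩ := (Abelian.Ext.mk₀_bijective _ _).2 x
  rw [Abelian.Ext.mk₀_comp_mk₀] at hx
  exact ⟨g.hom, congr($((Abelian.Ext.mk₀_bijective _ _).1 hx).hom)⟩

lemma exists_extend_of_subsingleton_ext_one (hi : Function.Injective i)
    (hip : Function.Exact i p) (hp : Function.Surjective p)
    (hX : Subsingleton (Abelian.Ext (ModuleCat.of R D) (ModuleCat.of R X) 1)) (f : A →ₗ[R] X) :
    ∃ g : B →ₗ[R] X, g ∘ₗ i = f := by
  obtain ⟨x, hx⟩ := Abelian.Ext.contravariant_sequence_exact₁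
    (shortExact_ofHom hi hip hp) (ModuleCat.of R X) (Abelian.Ext.mk₀ (ModuleCat.ofHom f))
    (add_zero 1) (Subsingleton.elim (h := hX) _ _)
  obtain ⟨g, rfl⟩ := (Abelian.Ext.mk₀_bijective _ _).2 x
  rw [Abelian.Ext.mk₀_comp_mk₀] at hx
  exact ⟨g.hom, congr($((Abelian.Ext.mk₀_bijective _ _).1 hx).hom)⟩

lemma subsingleton_ext_one_of_extend [Module.Projective R B] (hi : Function.Injective i)
    (hip : Function.Exact i p) (hp : Function.Surjective p)
    (h : ∀ f : A →ₗ[R] X, ∃ g : B →ₗ[R] X, g ∘ₗ i = f) :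
    Subsingleton (Abelian.Ext (ModuleCat.of R D) (ModuleCat.of R X) 1) := by
  have hS := shortExact_ofHom hi hip hp
  have : Projective (ModuleCat.of R B) := ModuleCat.projective_of_categoryTheory_projective _
  refine subsingleton_of_forall_eq 0 fun x ↦ ?_
  obtain ⟨y, rfl⟩ := Abelian.Ext.contravariant_sequence_exact₃ hS (ModuleCat.of R X) x
    (Abelian.Ext.eq_zero_of_projective _) (add_zero 1)
  obtain ⟨f, rfl⟩ := (Abelian.Ext.mk₀_bijective _ _).2 y
  obtain ⟨g, hg⟩ := h f.hom
  have hf : f = ModuleCat.ofHom i ≫ ModuleCat.ofHom g := by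
    ext1
    exact hg.symm
  rw [hf, ← Abelian.Ext.mk₀_comp_mk₀]
  exact hS.extClass_comp_assoc _

lemma subsingleton_ext_of_shortExact_right (hi : Function.Injective i)
    (hip : Function.Exact i p) (hp : Function.Surjective p) {n : ℕ}
    (hA : Subsingleton (Abelian.Ext (ModuleCat.of R X) (ModuleCat.of R A) (n + 1)))
    (hB : Subsingleton (Abelian.Ext (ModuleCat.of R X) (ModuleCat.of R B) n)) :
    Subsingleton (Abelian.Ext (ModuleCat.of R X) (ModuleCat.of R D) n) := by
  refine subsingleton_of_forall_eq 0 fun x ↦ ?_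
  obtain ⟨y, rfl⟩ := Abelian.Ext.covariant_sequence_exact₃ (ModuleCat.of R X)
    (shortExact_ofHom hi hip hp) x rfl (Subsingleton.elim (h := hA) _ _)
  rw [Subsingleton.elim (h := hB) y 0, Abelian.Ext.zero_comp]

lemma subsingleton_ext_succ_iff_of_projective [Module.Projective R B] (hi : Function.Injective i)
    (hip : Function.Exact i p) (hp : Function.Surjective p) (n : ℕ) :
    Subsingleton (Abelian.Ext (ModuleCat.of R D) (ModuleCat.of R X) (n + 2)) ↔
      Subsingleton (Abelian.Ext (ModuleCat.of R A) (ModuleCat.of R X) (n + 1)) := by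
  have hS := shortExact_ofHom hi hip hp
  have : Projective (ModuleCat.of R B) := ModuleCat.projective_of_categoryTheory_projective _
  constructor <;> refine fun h ↦ subsingleton_of_forall_eq 0 fun x ↦ ?_
  · obtain ⟨y, rfl⟩ := Abelian.Ext.contravariant_sequence_exact₁ hS (ModuleCat.of R X) x
      (add_comm 1 (n + 1)) (Subsingleton.elim (h := h) _ _)
    rw [Abelian.Ext.eq_zero_of_projective y, Abelian.Ext.comp_zero]
  · obtain ⟨y, rfl⟩ := Abelian.Ext.contravariant_sequence_exact₃ hS (ModuleCat.of R X) x
      (Abelian.Ext.eq_zero_of_projective _) (add_comm 1 (n + 1))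
    rw [Subsingleton.elim (h := h) y 0, Abelian.Ext.comp_zero]

end Ext

section Unit

variable {R : Type} [CommRing R] {C : Type} [AddCommGroup C] [Module R C]

/-- The part of the Auslander class condition that passes to cokernels `B ⧸ A` such that
`C ⊗ A → C ⊗ B` is injective: the natural map `A → Hom(C, C ⊗ A)` is surjective and
`Ext^i(C, C ⊗ A) = 0` for all `i ≥ 1`. -/
structure HasSurjectiveUnit (R : Type) [CommRing R] (C : Type) [AddCommGroup C] [Module R C]
    (A : Type) [AddCommGroup A] [Module R A] : Prop where
  exists_eq_tmul : ∀ f : C →ₗ[R] C ⊗[R] A, ∃ a : A, ∀ c, f c = c ⊗ₜ a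
  ext_vanish : ∀ n : ℕ, Subsingleton
    (Abelian.Ext (ModuleCat.of R C) (ModuleCat.of R (C ⊗[R] A)) (n + 1))

lemma MemAuslanderClass.hasSurjectiveUnit {A : Type} [AddCommGroup A] [Module R A]
    (h : MemAuslanderClass R C A) : HasSurjectiveUnit R C A where
  exists_eq_tmul f := by
    obtain ⟨a, rfl⟩ := h.bijective.2 f
    exact ⟨a, fun c ↦ rfl⟩
  ext_vanish n := (subsingleton_extMod_succ_iff_s8 n _ _).mp (h.ext_vanish _ (by omega))

lemma MemAuslanderClass.eq_zero_of_tmul_eq_zero {A : Type} [AddCommGroup A] [Module R A]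
    (h : MemAuslanderClass R C A) {a : A} (ha : ∀ c : C, c ⊗ₜ[R] a = 0) : a = 0 := by
  refine h.bijective.1 ?_
  ext c
  simpa using ha c

lemma IsSemidualizing.annihilator_eq_bot (hC : IsSemidualizing R C) :
    Module.annihilator R C = ⊥ := by
  refine (Submodule.eq_bot_iff _).mpr fun r hr ↦ hC.bijective.1 ?_
  ext c
  simpa using Module.mem_annihilator.mp hr c

variable {A B D X : Type} [AddCommGroup A] [Module R A] [AddCommGroup B] [Module R B]
  [AddCommGroup D] [Module R D] [AddCommGroup X] [Module R X]

lemma subsingleton_of_subsingleton_linearMap_s8 [IsNoetherianRing R] [Module.Finite R C]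
    [Module.Finite R X] (hC : Module.annihilator R C = ⊥) (h : Subsingleton (C →ₗ[R] X)) :
    Subsingleton X := by
  obtain ⟨r, hr, hreg⟩ := IsSMulRegular.subsingleton_linearMap_iff.mp h
  rw [hC, Submodule.mem_bot] at hr
  subst hr
  exact IsSMulRegular.zero_iff_subsingleton.mp hreg

lemma HasSurjectiveUnit.injective_of_tmul [IsNoetherianRing R] [Module.Finite R C]
    [Module.Finite R A] (hC : Module.annihilator R C = ⊥) (hA : HasSurjectiveUnit R C A)
    (ψ : C ⊗[R] A →ₗ[R] X) (hψ : ∀ a : A, (∀ c : C, ψ (c ⊗ₜ a) = 0) → a = 0) :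
    Function.Injective ψ := by
  rw [← LinearMap.ker_eq_bot, ← Submodule.subsingleton_iff_eq_bot]
  refine subsingleton_of_subsingleton_linearMap_s8 hC (subsingleton_of_forall_eq 0 fun f ↦ ?_)
  obtain ⟨a, ha⟩ := hA.exists_eq_tmul ((LinearMap.ker ψ).subtype ∘ₗ f)
  have ha0 : a = 0 := hψ a fun c ↦ by
    rw [← ha c]
    exact (f c).2
  ext c
  simpa [ha0] using ha c

lemma HasSurjectiveUnit.of_exact (hA : HasSurjectiveUnit R C A) (hB : HasSurjectiveUnit R C B)
    {i : A →ₗ[R] B} {p : B →ₗ[R] D} (hi : Function.Injective (i.lTensor C))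
    (hip : Function.Exact i p) (hp : Function.Surjective p) : HasSurjectiveUnit R C D where
  exists_eq_tmul f := by
    obtain ⟨g, rfl⟩ := exists_lift_of_subsingleton_ext_one hi (lTensor_exact C hip hp)
      (LinearMap.lTensor_surjective C hp) (hA.ext_vanish 0) f
    obtain ⟨b, hb⟩ := hB.exists_eq_tmul g
    exact ⟨p b, fun c ↦ by simp [hb]⟩
  ext_vanish n := subsingleton_ext_of_shortExact_right hi (lTensor_exact C hip hp)
    (LinearMap.lTensor_surjective C hp) (hA.ext_vanish (n + 1)) (hB.ext_vanish n)

end Unit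

section Hom

variable {R : Type} [CommRing R] {C : Type} [AddCommGroup C] [Module R C]
  {F K M N : Type} [AddCommGroup F] [Module R F] [AddCommGroup K] [Module R K]
  [AddCommGroup M] [Module R M] [AddCommGroup N] [Module R N]

lemma homTensorMap_tmul_apply (c : C) (φ : M →ₗ[R] N) (m : M) :
    homTensorMap R C M N (c ⊗ₜ φ) m = c ⊗ₜ φ m := rfl

lemma homTensorMap_lTensor_lcomp (π : F →ₗ[R] M) (z : C ⊗[R] (M →ₗ[R] N)) :
    homTensorMap R C F N ((LinearMap.lcomp R N π).lTensor C z) =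
      homTensorMap R C M N z ∘ₗ π := by
  induction z with
  | zero => simp
  | tmul c φ => rfl
  | add x y hx hy => simp [hx, hy, LinearMap.add_comp]

lemma homTensorMap_bijective_of_free [Module.Finite R F] [Module.Free R F] :
    Function.Bijective (homTensorMap R C F N) := by
  have : homTensorMap R C F N = (lTensorHomEquivHomLTensor R F C N).toLinearMap := by
    rw [lTensorHomEquivHomLTensor_toLinearMap]
    ext c φ m
    rfl
  rw [this]
  exact (lTensorHomEquivHomLTensor R F C N).bijective

lemma HasSurjectiveUnit.hom_of_free [Module.Finite R F] [Module.Free R F]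
    (hN : HasSurjectiveUnit R C N) : HasSurjectiveUnit R C (F →ₗ[R] N) where
  exists_eq_tmul f := by
    let b := Module.Free.chooseBasis R F
    choose x hx using fun i ↦ hN.exists_eq_tmul
      (LinearMap.applyₗ (b i) ∘ₗ homTensorMap R C F N ∘ₗ f)
    refine ⟨b.constr R x, fun c ↦ homTensorMap_bijective_of_free.1 (b.ext fun i ↦ ?_)⟩
    simpa [homTensorMap_tmul_apply] using hx i c
  ext_vanish n := subsingleton_ext_of_linearEquiv_pi
    ((LinearEquiv.ofBijective _ homTensorMap_bijective_of_free).trans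
      ((Module.Free.chooseBasis R F).constr R).symm) n (hN.ext_vanish n)

lemma eq_zero_of_homTensorMap_tmul_eq_zero
    (hN : ∀ x : N, (∀ c : C, c ⊗ₜ[R] x = 0) → x = 0) {φ : M →ₗ[R] N}
    (hφ : ∀ c : C, homTensorMap R C M N (c ⊗ₜ φ) = 0) : φ = 0 := by
  ext m
  exact hN _ fun c ↦ congr($(hφ c) m)

variable [IsNoetherianRing R] [Module.Finite R C] [Module.Finite R M] [Module.Finite R N]

lemma lTensor_lcomp_injective (hC : Module.annihilator R C = ⊥)
    (hN : ∀ x : N, (∀ c : C, c ⊗ₜ[R] x = 0) → x = 0)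
    (hM : HasSurjectiveUnit R C (M →ₗ[R] N)) {π : F →ₗ[R] M} (hπ : Function.Surjective π) :
    Function.Injective ((LinearMap.lcomp R N π).lTensor C) := by
  refine hM.injective_of_tmul hC _ fun φ hφ ↦ ?_
  have : φ ∘ₗ π = 0 := eq_zero_of_homTensorMap_tmul_eq_zero hN fun c ↦ by
    have := congr(homTensorMap R C F N $(hφ c))
    rwa [map_zero] at this
  exact (LinearMap.cancel_right hπ).mp (this.trans (LinearMap.zero_comp π).symm)

lemma homTensorMap_surjective (hC : Module.annihilator R C = ⊥)
    (hN : ∀ x : N, (∀ c : C, c ⊗ₜ[R] x = 0) → x = 0) (hNC : HasSurjectiveUnit R C N)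
    (hM : HasSurjectiveUnit R C (M →ₗ[R] N)) :
    Function.Surjective (homTensorMap R C M N) := by
  intro g
  obtain ⟨F, _, _, _, _, π, hπ⟩ := Module.exists_finite_presentation R M
  let K := LinearMap.ker π
  let p := LinearMap.lcomp R N K.subtype
  have hexact : Function.Exact (LinearMap.lcomp R N π) p.rangeRestrict := by
    intro f
    rw [← LinearMap.exact_lcomp_of_exact_of_surjective N (LinearMap.exact_subtype_ker_map π) hπ f]
    exact Subtype.ext_iff
  have hQ : HasSurjectiveUnit R C (LinearMap.range p) := hM.of_exact hNC.hom_of_free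
    (lTensor_lcomp_injective hC hN hM hπ) hexact p.surjective_rangeRestrict
  have hinj : Function.Injective
      (homTensorMap R C K N ∘ₗ (LinearMap.range p).subtype.lTensor C) := by
    refine hQ.injective_of_tmul hC _ fun φ hφ ↦ Subtype.ext ?_
    exact eq_zero_of_homTensorMap_tmul_eq_zero hN hφ
  obtain ⟨y, hy⟩ := homTensorMap_bijective_of_free.2 (g ∘ₗ π)
  obtain ⟨z, rfl⟩ := (lTensor_exact C hexact p.surjective_rangeRestrict y).mp (hinj (by
    rw [map_zero, LinearMap.comp_apply, ← LinearMap.lTensor_comp_apply,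
      LinearMap.subtype_comp_codRestrict, homTensorMap_lTensor_lcomp, hy]
    ext k
    simp [show π k = 0 from k.2]))
  rw [homTensorMap_lTensor_lcomp, LinearMap.cancel_right hπ] at hy
  exact ⟨z, hy⟩

lemma subsingleton_ext_tensor_of_hasSurjectiveUnit (hC : Module.annihilator R C = ⊥)
    (hN : ∀ x : N, (∀ c : C, c ⊗ₜ[R] x = 0) → x = 0) (hNC : HasSurjectiveUnit R C N)
    (hM : HasSurjectiveUnit R C (M →ₗ[R] N)) (t : ℕ)
    (hext : ∀ n < t,
      Subsingleton (Abelian.Ext (ModuleCat.of R M) (ModuleCat.of R N) (n + 1))) :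
    ∀ n < t,
      Subsingleton (Abelian.Ext (ModuleCat.of R M) (ModuleCat.of R (C ⊗[R] N)) (n + 1)) := by
  induction t generalizing M with
  | zero => simp
  | succ t ih =>
    obtain ⟨F, _, _, _, _, π, hπ⟩ := Module.exists_finite_presentation R M
    let K := LinearMap.ker π
    have hK := LinearMap.exact_subtype_ker_map π
    have hp : Function.Surjective (LinearMap.lcomp R N K.subtype) :=
      exists_extend_of_subsingleton_ext_one K.subtype_injective hK hπ (hext 0 t.succ_pos)
    have hKN : HasSurjectiveUnit R C (K →ₗ[R] N) := hM.of_exact hNC.hom_of_free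
      (lTensor_lcomp_injective hC hN hM hπ)
        (LinearMap.exact_lcomp_of_exact_of_surjective N hK hπ) hp
    rintro (_ | n) hn
    · refine subsingleton_ext_one_of_extend K.subtype_injective hK hπ fun f ↦ ?_
      obtain ⟨z, rfl⟩ := homTensorMap_surjective hC hN hNC hKN f
      obtain ⟨y, rfl⟩ := LinearMap.lTensor_surjective C hp z
      exact ⟨_, (homTensorMap_lTensor_lcomp _ _).symm⟩
    · rw [subsingleton_ext_succ_iff_of_projective K.subtype_injective hK hπ]
      refine ih hKN (fun m hm ↦ ?_) n (by omega)
      rw [← subsingleton_ext_succ_iff_of_projective K.subtype_injective hK hπ]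
      exact hext (m + 1) (by omega)

end Hom

theorem ext_tensor_vanishing_of_auslander_class
    (R : Type) [CommRing R] [IsNoetherianRing R] [IsLocalRing R]
    (C : Type) [AddCommGroup C] [Module R C] [Module.Finite R C]
    (hC : IsSemidualizing R C) (t : ℕ)
    (M N : Type) [AddCommGroup M] [Module R M] [AddCommGroup N] [Module R N]
    [Module.Finite R M] [Module.Finite R N]
    (hHom : MemAuslanderClass R C (M →ₗ[R] N))
    (hN : MemAuslanderClass R C N)
    (hext : ∀ i : ℕ, 1 ≤ i → i ≤ t → Subsingleton (extMod R i M N)) :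
    ∀ i : ℕ, 1 ≤ i → i ≤ t → Subsingleton (extMod R i M (TensorProduct R C N)) := by
  rintro (_ | n) h1 h2
  · omega
  · exact (subsingleton_extMod_succ_iff_s8 n _ _).mpr <|
      subsingleton_ext_tensor_of_hasSurjectiveUnit hC.annihilator_eq_bot
        (fun _ ↦ hN.eq_zero_of_tmul_eq_zero) hN.hasSurjectiveUnit hHom.hasSurjectiveUnit t
        (fun m hm ↦ (subsingleton_extMod_succ_iff_s8 m _ _).mp (hext _ (by omega) hm)) n h2
end
end
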